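/- Let r = (R_j)_{j≥1} be a generic sequence of radii and c ∈ C(r). Let ε = (ε_j)_{j≥2}, m = (m_j)_{j≥1}, ℓ = (ℓ_j)_{j≥2} be sequences such that for every k ≥ 1 conditions (3.2) at k, (3.3) for k, (3.4) for k, and (3.5) at k all hold, and let α be the itinerary associated to m and ℓ. If x ∈ ℂ_p satisfies f_c^{∘n}(x) ∈ B_0 for 0 ≤ n < m_1, f_c^{∘n}(x) ∈ A for m_1 ≤ n < m_1 + n_1, and f_c^{∘n}(x) ∈ B_1 for all n ≥ m_1 + n_1, then there exists c' ∈ Δ_2(c,ε) such that every y ∈ ℂ_p with |y − x| < ϱ² lies in the cylinder C_{c'}(α); in particular x itself has itinerary α under f_{c'}. -/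

import Mathlib

noncomputable section

/-- `K` is a model of `ℂ_p`, the completion of an algebraic closure of `ℚ_p`:
it is a complete, algebraically closed, nonarchimedean normed field whose norm
extends the `p`-adic absolute value and in which the algebraic elements over
`ℚ_p` are dense. -/
structure IsCp (p : ℕ) [Fact p.Prime] (K : Type*) [NormedField K] [Algebra ℚ_[p] K] : Prop where
  complete : CompleteSpace K
  norm_extends : ∀ x : ℚ_[p], ‖algebraMap ℚ_[p] K x‖ = ‖x‖
  isAlgClosed : IsAlgClosed K
  dense_algebraic : Dense {x : K | IsAlgebraic ℚ_[p] x}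
  isNonarch : ∀ x y : K, ‖x + y‖ ≤ max ‖x‖ ‖y‖

/-- `ϱ = p^{-1/(p-1)}`. -/
def rho (p : ℕ) : ℝ := (p : ℝ) ^ (-1 / ((p : ℝ) - 1))

/-- `R` is a sequence of radii: strictly increasing (for indices `≥ 1`),
with `R 1 > p`, tending to infinity. -/
def IsRadii (p : ℕ) (R : ℕ → ℝ) : Prop :=
  (∀ j, 1 ≤ j → R j < R (j + 1)) ∧ (p : ℝ) < R 1 ∧
    Filter.Tendsto R Filter.atTop Filter.atTop

/-- The piecewise-monomial map `φ`: for `R_{j-1} < t ≤ R_j` (with `R_0 := 0`),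
`φ(t) = p (R_1 ⋯ R_{j-1})⁻¹ t^{p+j-1}`. -/
def phi (p : ℕ) (R : ℕ → ℝ) (t : ℝ) : ℝ :=
  let j := sInf {j : ℕ | 1 ≤ j ∧ t ≤ R j}
  (p : ℝ) * (∏ i ∈ Finset.Icc 1 (j - 1), R i)⁻¹ * t ^ (p + j - 1)

/-- A generic sequence of radii. -/
def IsGenericRadii (p : ℕ) (R : ℕ → ℝ) : Prop :=
  IsRadii p R ∧ ∀ i j n : ℕ, 1 ≤ i → i < j → 1 ≤ n → (phi p R)^[n] (R i) ≠ R j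

/-- Membership in the parameter space `C(r)`: `|c_j| = R_j` for all `j ≥ 1`. -/
def InC (p : ℕ) [Fact p.Prime] {K : Type*} [NormedField K] (R : ℕ → ℝ) (c : ℕ → K) : Prop :=
  ∀ j, 1 ≤ j → ‖c j‖ = R j

/-- The transcendental entire map `f_c(z) = (z^p/p) ∏_{j ≥ 1} (1 - z/c_j)`. -/
def fc (p : ℕ) {K : Type*} [NormedField K] (c : ℕ → K) (z : K) : K :=
  z ^ p / (p : K) * ∏' j : ℕ, (1 - z / c (j + 1))

/-- The disk `B_0 = {|z| < 1}` for `j = 0`, and `B_j = {|z - c_j| < R_j}` for `j ≥ 1`. -/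
def Bset {K : Type*} [NormedField K] (R : ℕ → ℝ) (c : ℕ → K) (j : ℕ) : Set K :=
  if j = 0 then {z : K | ‖z‖ < 1} else {z : K | ‖z - c j‖ < R j}

/-- The set `A`, complement of all the disks `B_j`, `j ≥ 0`. -/
def Aset {K : Type*} [NormedField K] (R : ℕ → ℝ) (c : ℕ → K) : Set K :=
  (⋃ j, Bset R c j)ᶜ

/-- `n_j`, the minimal `n ≥ 1` with `R_j < φ^{∘(n+1)}(1)`. -/
def nseq (p : ℕ) (R : ℕ → ℝ) (j : ℕ) : ℕ :=
  sInf {n : ℕ | 1 ≤ n ∧ R j < (phi p R)^[n + 1] 1}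

/-- `S_j = φ⁻¹(R_j)`. -/
def Sse (p : ℕ) (R : ℕ → ℝ) (j : ℕ) : ℝ := Function.invFun (phi p R) (R j)

/-- `λ_j = φ(R_j)/R_j`. -/
def lam (p : ℕ) (R : ℕ → ℝ) (j : ℕ) : ℝ := phi p R (R j) / R j

/-- `L_k`: index of the first symbol of the `k`-th block `B_0^{m_k} A^{n_k} B_k^{…}`
of the itinerary `α(m, ℓ)`; `L_1 = 0` and `L_{k+1} = L_k + m_k + n_k + ℓ_{k+1}`. -/
def Lseq (m n l : ℕ → ℕ) : ℕ → ℕ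
  | 0 => 0
  | 1 => 0
  | k + 2 => Lseq m n l (k + 1) + m (k + 1) + n (k + 1) + l (k + 2)

/-- `N_k = L_k + m_k + n_k`, the index of the final symbol `B_k` of the truncated
itinerary `α^{(k)}` (so `α^{(k)}` has length `N_k + 1`). -/
def Nseq (m n l : ℕ → ℕ) (k : ℕ) : ℕ := Lseq m n l k + m k + n k

/-- The symbol (`some 0 = B_0`, `none = A`, `some k = B_k`) at position `i` of the
itinerary `α(m,ℓ) = B_0^{m_1} A^{n_1} B_1^{ℓ_2} B_0^{m_2} A^{n_2} B_2^{ℓ_3} ⋯`. -/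
def itin (m n l : ℕ → ℕ) (i : ℕ) : Option ℕ :=
  let k := sSup {k : ℕ | 1 ≤ k ∧ Lseq m n l k ≤ i}
  if i < Lseq m n l k + m k then some 0
  else if i < Lseq m n l k + m k + n k then none
  else some k

/-- The subset of `ℂ_p` corresponding to a symbol of the alphabet `{A, B_0, B_1, …}`. -/
def symbSet {K : Type*} [NormedField K] (R : ℕ → ℝ) (c : ℕ → K) : Option ℕ → Set K
  | none => Aset R c
  | some j => Bset R c j

/-- Condition (3.2) at `k`: `ϱ⁻¹ R_k p^{-m_k} λ_k^{ℓ_{k+1}} < 1`. -/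
def Cond32 (p : ℕ) (R : ℕ → ℝ) (m l : ℕ → ℕ) (k : ℕ) : Prop :=
  (rho p)⁻¹ * R k * ((p : ℝ) ^ m k)⁻¹ * lam p R k ^ l (k + 1) < 1

/-- Condition (3.3) for `k`: for all `2 ≤ j < k`,
`ε_k < ϱ^{k-j} R_k² (R_{j-1} S_{j-1})⁻¹ λ_{j-1}^{-ℓ_j}`. -/
def Cond33 (p : ℕ) (R : ℕ → ℝ) (ε : ℕ → ℝ) (l : ℕ → ℕ) (k : ℕ) : Prop :=
  ∀ j, 2 ≤ j → j < k →
    ε k < rho p ^ (k - j) * R k ^ 2 * (R (j - 1) * Sse p R (j - 1))⁻¹ *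
      (lam p R (j - 1) ^ l j)⁻¹

/-- Condition (3.4) for `k`: for all `2 ≤ j ≤ k`,
`ϱ^{-2} R_{j-1} S_{j-1} λ_{j-1}^{ℓ_j} p^{-m_j} < 1`. -/
def Cond34 (p : ℕ) (R : ℕ → ℝ) (m l : ℕ → ℕ) (k : ℕ) : Prop :=
  ∀ j, 2 ≤ j → j ≤ k →
    ((rho p) ^ 2)⁻¹ * (R (j - 1) * Sse p R (j - 1)) * lam p R (j - 1) ^ l j *
      ((p : ℝ) ^ m j)⁻¹ < 1

/-- Condition (3.5) at `k`: `p ϱ⁻¹ R_{k+1}² S_k⁻¹ λ_k^{-ℓ_{k+1}} < ε_{k+1}`. -/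
def Cond35 (p : ℕ) (R : ℕ → ℝ) (ε : ℕ → ℝ) (l : ℕ → ℕ) (k : ℕ) : Prop :=
  (p : ℝ) * (rho p)⁻¹ * R (k + 1) ^ 2 * (Sse p R k)⁻¹ * (lam p R k ^ l (k + 1))⁻¹ < ε (k + 1)

/-- `c' ∈ Δ_k(c, ε)`. -/
def InDelta (p : ℕ) [Fact p.Prime] {K : Type*} [NormedField K] (R : ℕ → ℝ) (c : ℕ → K)
    (ε : ℕ → ℝ) (k : ℕ) (c' : ℕ → K) : Prop :=
  InC p R c' ∧ (∀ j, 1 ≤ j → j < k → c' j = c j) ∧ ∀ j, k ≤ j → ‖c' j - c j‖ < ε j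

/-- `c' ∈ U_k(c, ε)`. -/
def InU (p : ℕ) [Fact p.Prime] {K : Type*} [NormedField K] (R : ℕ → ℝ) (c : ℕ → K)
    (k : ℕ) (ε : ℝ) (c' : ℕ → K) : Prop :=
  InC p R c' ∧ ‖c' k - c k‖ < ε ∧ ∀ j, 1 ≤ j → j ≠ k → c' j = c j

open Filter Topology

set_option linter.unusedSectionVars false

/-! ### The comparison function `phi` -/

section Radii

variable {p : ℕ} {R : ℕ → ℝ}

theorem IsRadii.lt (hR : IsRadii p R) {i j : ℕ} (hi : 1 ≤ i) (hij : i < j) : R i < R j := by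
  induction j, hij using Nat.le_induction with
  | base => exact hR.1 i hi
  | succ n hn ih => exact ih.trans (hR.1 n (by omega))

theorem IsRadii.le (hR : IsRadii p R) {i j : ℕ} (hi : 1 ≤ i) (hij : i ≤ j) : R i ≤ R j := by
  rcases hij.eq_or_lt with rfl | h
  · exact le_rfl
  · exact (hR.lt hi h).le

theorem IsRadii.prime_lt (hR : IsRadii p R) {j : ℕ} (hj : 1 ≤ j) : (p : ℝ) < R j :=
  hR.2.1.trans_le (hR.le le_rfl hj)

theorem IsRadii.pos (hR : IsRadii p R) {j : ℕ} (hj : 1 ≤ j) : 0 < R j :=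
  (Nat.cast_nonneg p).trans_lt (hR.prime_lt hj)

theorem IsRadii.exists_lt (hR : IsRadii p R) (t : ℝ) : ∃ J : ℕ, t < R (J + 1) := by
  obtain ⟨N, hN⟩ := eventually_atTop.1 (hR.2.2.eventually_gt_atTop t)
  exact ⟨N, hN (N + 1) (by omega)⟩

theorem phi_eq (hR : IsRadii p R) {t : ℝ} {J : ℕ} (hJ : t ≤ R (J + 1)) :
    phi p R t = p * t ^ p * ∏ i ∈ Finset.range J, max 1 (t / R (i + 1)) := by
  have hne : {j : ℕ | 1 ≤ j ∧ t ≤ R j}.Nonempty := ⟨J + 1, by simp, hJ⟩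
  set j := sInf {j : ℕ | 1 ≤ j ∧ t ≤ R j} with hj
  have hmem : 1 ≤ j ∧ t ≤ R j := Nat.sInf_mem hne
  have hjJ : j ≤ J + 1 := Nat.sInf_le ⟨by simp, hJ⟩
  have hlt : ∀ i, 1 ≤ i → i < j → R i < t := fun i hi hij => by
    by_contra h
    exact Nat.notMem_of_lt_sInf hij ⟨hi, not_lt.1 h⟩
  obtain ⟨q, hq⟩ : ∃ q, j = q + 1 := ⟨j - 1, by omega⟩
  have hqJ : q ≤ J := by omega
  obtain ⟨d, rfl⟩ := Nat.exists_eq_add_of_le hqJ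
  rw [Finset.prod_range_add]
  have h2 : ∏ x ∈ Finset.range d, max 1 (t / R (q + x + 1)) = 1 := by
    refine Finset.prod_eq_one fun x _ => max_eq_left ?_
    rw [div_le_one (hR.pos (by omega))]
    exact hmem.2.trans (hR.le hmem.1 (by omega))
  have h1 : ∏ x ∈ Finset.range q, max 1 (t / R (x + 1)) =
      t ^ q * (∏ i ∈ Finset.Icc 1 q, R i)⁻¹ := by
    have h3 : ∏ i ∈ Finset.Icc 1 q, R i = ∏ x ∈ Finset.range q, R (x + 1) := by
      rw [Finset.range_eq_Ico, Finset.prod_Ico_add' (fun i => R i) 0 q 1]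
      rfl
    rw [h3, ← Finset.prod_inv_distrib]
    have : t ^ q = ∏ x ∈ Finset.range q, t := by simp
    rw [this, ← Finset.prod_mul_distrib]
    refine Finset.prod_congr rfl fun x hx => ?_
    rw [Finset.mem_range] at hx
    rw [max_eq_right, div_eq_mul_inv]
    rw [le_div_iff₀ (hR.pos (by omega)), one_mul]
    exact (hlt (x + 1) (by omega) (by omega)).le
  rw [h2, h1]
  have : phi p R t = (p : ℝ) * (∏ i ∈ Finset.Icc 1 (j - 1), R i)⁻¹ * t ^ (p + j - 1) := rfl
  rw [this, hq]
  simp only [Nat.add_sub_cancel, ← Nat.add_assoc]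
  ring

theorem phi_eq_of_le (hR : IsRadii p R) {t : ℝ} (ht : t ≤ R 1) : phi p R t = p * t ^ p := by
  simpa using phi_eq (J := 0) hR ht

theorem phi_continuousAt (hR : IsRadii p R) (t : ℝ) : ContinuousAt (phi p R) t := by
  obtain ⟨J, hJ⟩ := hR.exists_lt t
  have h : ContinuousAt
      (fun t : ℝ => p * t ^ p * ∏ i ∈ Finset.range J, max 1 (t / R (i + 1))) t := by
    fun_prop
  refine h.congr ?_
  filter_upwards [eventually_lt_nhds hJ] with u hu
  exact (phi_eq hR hu.le).symm

theorem phi_continuous (hR : IsRadii p R) : Continuous (phi p R) :=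
  continuous_iff_continuousAt.2 (phi_continuousAt hR)

theorem mul_pow_le_phi (hR : IsRadii p R) {t : ℝ} (ht : 0 ≤ t) : p * t ^ p ≤ phi p R t := by
  obtain ⟨J, hJ⟩ := hR.exists_lt t
  rw [phi_eq hR hJ.le]
  refine le_mul_of_one_le_right (by positivity) ?_
  calc (1 : ℝ) = ∏ _i ∈ Finset.range J, 1 := by simp
    _ ≤ _ := Finset.prod_le_prod (fun _ _ => zero_le_one) fun i _ => le_max_left _ _

variable [hp : Fact p.Prime]

theorem prime_pos_real : (0 : ℝ) < p := by exact_mod_cast hp.out.pos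

theorem two_le_prime_real : (2 : ℝ) ≤ p := by exact_mod_cast hp.out.two_le

theorem phi_pos (hR : IsRadii p R) {t : ℝ} (ht : 0 < t) : 0 < phi p R t := by
  have := prime_pos_real (p := p)
  exact lt_of_lt_of_le (by positivity) (mul_pow_le_phi hR ht.le)

theorem phi_mul_lt (hR : IsRadii p R) {t u : ℝ} (ht : 0 < t) (htu : t < u) :
    phi p R t * u < phi p R u * t := by
  have hp0 := prime_pos_real (p := p)
  have hu := ht.trans htu
  obtain ⟨J, hJ⟩ := hR.exists_lt u
  rw [phi_eq hR hJ.le, phi_eq hR (htu.trans hJ).le]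
  have h1 : ∏ i ∈ Finset.range J, max 1 (t / R (i + 1)) ≤
      ∏ i ∈ Finset.range J, max 1 (u / R (i + 1)) := by
    refine Finset.prod_le_prod (fun i _ => by positivity) fun i _ => ?_
    have := hR.pos (j := i + 1) (by omega)
    gcongr
  have h2 : (0 : ℝ) < ∏ i ∈ Finset.range J, max 1 (u / R (i + 1)) :=
    Finset.prod_pos fun i _ => by positivity
  obtain ⟨q, hq⟩ : ∃ q, p = q + 1 := ⟨p - 1, by have := hp.out.two_le; omega⟩
  have hq0 : q ≠ 0 := by have := hp.out.two_le; omega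
  have h3 : t ^ p * u < u ^ p * t := by
    have : t ^ q < u ^ q := pow_lt_pow_left₀ htu ht.le hq0
    rw [hq, pow_succ, pow_succ]
    have : t ^ q * (t * u) < u ^ q * (t * u) := by gcongr
    linarith
  calc p * t ^ p * (∏ i ∈ Finset.range J, max 1 (t / R (i + 1))) * u
      = p * (t ^ p * u) * ∏ i ∈ Finset.range J, max 1 (t / R (i + 1)) := by ring
    _ ≤ p * (t ^ p * u) * ∏ i ∈ Finset.range J, max 1 (u / R (i + 1)) := by gcongr
    _ < p * (u ^ p * t) * ∏ i ∈ Finset.range J, max 1 (u / R (i + 1)) := by gcongr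
    _ = _ := by ring

theorem phi_lt_phi (hR : IsRadii p R) {t u : ℝ} (ht : 0 < t) (htu : t < u) :
    phi p R t < phi p R u := by
  have h1 := phi_mul_lt hR ht htu
  have h2 := phi_pos hR ht
  by_contra h
  push Not at h
  have h3 := phi_pos hR (ht.trans htu)
  nlinarith

theorem phi_le_phi (hR : IsRadii p R) {t u : ℝ} (ht : 0 < t) (htu : t ≤ u) :
    phi p R t ≤ phi p R u := by
  rcases htu.eq_or_lt with rfl | h
  · exact le_rfl
  · exact (phi_lt_phi hR ht h).le

theorem phi_inj (hR : IsRadii p R) {t u : ℝ} (ht : 0 < t) (hu : 0 < u)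
    (h : phi p R t = phi p R u) : t = u := by
  rcases lt_trichotomy t u with h1 | h1 | h1
  · exact absurd h (phi_lt_phi hR ht h1).ne
  · exact h1
  · exact absurd h (phi_lt_phi hR hu h1).ne'

theorem phi_iterate_pos (hR : IsRadii p R) {t : ℝ} (ht : 0 < t) (n : ℕ) :
    0 < (phi p R)^[n] t := by
  induction n with
  | zero => exact ht
  | succ n ih => rw [Function.iterate_succ_apply']; exact phi_pos hR ih

theorem phi_iterate_lt (hR : IsRadii p R) {t u : ℝ} (ht : 0 < t) (htu : t < u) (n : ℕ) :
    (phi p R)^[n] t < (phi p R)^[n] u := by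
  induction n with
  | zero => exact htu
  | succ n ih =>
    rw [Function.iterate_succ_apply', Function.iterate_succ_apply']
    exact phi_lt_phi hR (phi_iterate_pos hR ht n) ih

theorem phi_iterate_inj (hR : IsRadii p R) {t u : ℝ} (ht : 0 < t) (hu : 0 < u) (n : ℕ)
    (h : (phi p R)^[n] t = (phi p R)^[n] u) : t = u := by
  rcases lt_trichotomy t u with h1 | h1 | h1
  · exact absurd h (phi_iterate_lt hR ht h1 n).ne
  · exact h1
  · exact absurd h (phi_iterate_lt hR hu h1 n).ne'

theorem phi_one (hR : IsRadii p R) : phi p R 1 = p := by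
  have h1 : (1 : ℝ) ≤ R 1 := by
    have := two_le_prime_real (p := p)
    have := hR.2.1
    linarith
  simp [phi_eq_of_le hR h1]

theorem exists_phi_eq (hR : IsRadii p R) {y : ℝ} (hy : 0 < y) : ∃ t, 0 < t ∧ phi p R t = y := by
  have hp2 := two_le_prime_real (p := p)
  have h0 : phi p R 0 = 0 := by
    rw [phi_eq_of_le hR (hR.pos le_rfl).le]
    simp [hp.out.ne_zero]
  have h1 : y ≤ phi p R (y + 1) := by
    refine le_trans ?_ (mul_pow_le_phi hR (by positivity))
    have : y + 1 ≤ (y + 1) ^ p := le_self_pow₀ (by linarith) hp.out.ne_zero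
    nlinarith
  obtain ⟨t, ht, hty⟩ := intermediate_value_Icc (by positivity : (0 : ℝ) ≤ y + 1)
    (phi_continuous hR).continuousOn ⟨h0.trans_le hy.le, h1⟩
  refine ⟨t, ht.1.lt_of_ne ?_, hty⟩
  rintro rfl
  rw [h0] at hty
  exact hy.ne hty

theorem exists_phi_iterate_eq (hR : IsRadii p R) (n : ℕ) {y : ℝ} (hy : 0 < y) :
    ∃ t, 0 < t ∧ (phi p R)^[n] t = y := by
  induction n generalizing y with
  | zero => exact ⟨y, hy, rfl⟩
  | succ n ih =>
    obtain ⟨u, hu, huy⟩ := exists_phi_eq hR hy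
    obtain ⟨t, ht, htu⟩ := ih hu
    exact ⟨t, ht, by rw [Function.iterate_succ_apply', htu, huy]⟩

theorem lt_phi_of_one_le (hR : IsRadii p R) {t : ℝ} (ht : 1 ≤ t) : t < phi p R t := by
  have hp2 := two_le_prime_real (p := p)
  have h1 := mul_pow_le_phi hR (zero_le_one.trans ht)
  have : t ≤ t ^ p := le_self_pow₀ ht hp.out.ne_zero
  nlinarith

/-! ### The number `ϱ` -/

theorem rho_pos : 0 < rho p := Real.rpow_pos_of_pos prime_pos_real _

theorem rho_lt_one : rho p < 1 := by
  have := two_le_prime_real (p := p)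
  exact Real.rpow_lt_one_of_one_lt_of_neg (by linarith)
    (div_neg_of_neg_of_pos (by norm_num) (by linarith))

theorem rho_pow : rho p ^ (p - 1) = (p : ℝ)⁻¹ := by
  have := two_le_prime_real (p := p)
  rw [rho, ← Real.rpow_natCast, ← Real.rpow_mul (by linarith), Nat.cast_sub hp.out.one_le]
  rw [Nat.cast_one, div_mul_cancel₀ _ (by linarith), Real.rpow_neg_one]

theorem phi_rho (hR : IsRadii p R) : phi p R (rho p) = rho p := by
  have h2 := two_le_prime_real (p := p)
  have h1 : rho p ≤ R 1 := by
    have := rho_lt_one (p := p)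
    have := hR.2.1
    linarith
  have h3 : rho p ^ p = rho p ^ (p - 1) * rho p := by
    rw [← pow_succ, Nat.sub_add_cancel hp.out.one_le]
  rw [phi_eq_of_le hR h1, h3, rho_pow, mul_inv_cancel_left₀ (by linarith)]

theorem lt_phi (hR : IsRadii p R) {t : ℝ} (ht : rho p < t) : t < phi p R t := by
  have h := phi_mul_lt hR rho_pos ht
  rw [phi_rho hR, mul_comm (phi p R t)] at h
  exact lt_of_mul_lt_mul_left h rho_pos.le

theorem rho_lt_phi_iterate (hR : IsRadii p R) {t : ℝ} (ht : rho p < t) (n : ℕ) :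
    rho p < (phi p R)^[n] t := by
  induction n with
  | zero => exact ht
  | succ n ih => rw [Function.iterate_succ_apply']; exact ih.trans (lt_phi hR ih)

theorem phi_iterate_strictMono (hR : IsRadii p R) {t : ℝ} (ht : rho p < t) :
    StrictMono fun n => (phi p R)^[n] t := by
  refine strictMono_nat_of_lt_succ fun n => ?_
  rw [Function.iterate_succ_apply']
  exact lt_phi hR (rho_lt_phi_iterate hR ht n)

theorem tendsto_phi_iterate_one (hR : IsRadii p R) :
    Tendsto (fun n => (phi p R)^[n] 1) atTop atTop := by
  have hp2 := two_le_prime_real (p := p)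
  have h : ∀ n, 1 ≤ (phi p R)^[n] 1 ∧ (2 : ℝ) ^ n ≤ (phi p R)^[n] 1 := by
    intro n
    induction n with
    | zero => simp
    | succ n ih =>
      rw [Function.iterate_succ_apply']
      set t := (phi p R)^[n] 1
      have h1 := mul_pow_le_phi hR (zero_le_one.trans ih.1)
      have h2 : t ≤ t ^ p := le_self_pow₀ ih.1 hp.out.ne_zero
      have h3 : 2 * t ≤ phi p R t := by nlinarith
      exact ⟨by linarith, by rw [pow_succ]; linarith⟩
  exact tendsto_atTop_mono (fun n => (h n).2) (tendsto_pow_atTop_atTop_of_one_lt one_lt_two)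

theorem nseq_spec (hR : IsRadii p R) {k : ℕ} (hk : 1 ≤ k) :
    1 ≤ nseq p R k ∧ (phi p R)^[nseq p R k] 1 ≤ R k ∧ R k < (phi p R)^[nseq p R k + 1] 1 := by
  have hne : {n : ℕ | 1 ≤ n ∧ R k < (phi p R)^[n + 1] 1}.Nonempty := by
    obtain ⟨N, hN⟩ := eventually_atTop.1 ((tendsto_phi_iterate_one hR).eventually_gt_atTop (R k))
    exact ⟨N + 1, by omega, hN _ (by omega)⟩
  have hmem : 1 ≤ nseq p R k ∧ R k < (phi p R)^[nseq p R k + 1] 1 := Nat.sInf_mem hne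
  refine ⟨hmem.1, ?_, hmem.2⟩
  rcases hmem.1.eq_or_lt with h | h
  · rw [← h, Function.iterate_one, phi_one hR]
    exact (hR.prime_lt hk).le
  · by_contra hlt
    have h2 : nseq p R k - 1 < nseq p R k := by omega
    refine Nat.notMem_of_lt_sInf h2 ⟨by omega, ?_⟩
    rw [Nat.sub_add_cancel hmem.1]
    exact not_le.1 hlt

end Radii

/-! ### The maps `f_c` in terms of the inverse zeros -/

/-- The map `f_c` written in terms of the inverses `v_j = c_j⁻¹` of its nonzero zeros. -/
def gf (p : ℕ) {K : Type*} [NormedField K] (v : ℕ → K) (z : K) : K :=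
  z ^ p / (p : K) * ∏' j : ℕ, (1 - v (j + 1) * z)

theorem fc_eq_gf (p : ℕ) {K : Type*} [NormedField K] (c : ℕ → K) :
    fc p c = gf p fun j => (c j)⁻¹ := by
  funext z
  simp only [fc, gf, div_eq_mul_inv, mul_comm]

/-- All `v_j` have norm at most `R_j⁻¹`. -/
def InvBound {K : Type*} [NormedField K] (R : ℕ → ℝ) (v : ℕ → K) : Prop :=
  ∀ j, 1 ≤ j → ‖v j‖ ≤ (R j)⁻¹

/-- All `v_j` have norm exactly `R_j⁻¹`. -/
def InvRadii {K : Type*} [NormedField K] (R : ℕ → ℝ) (v : ℕ → K) : Prop :=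
  ∀ j, 1 ≤ j → ‖v j‖ = (R j)⁻¹

theorem InvRadii.invBound {K : Type*} [NormedField K] {R : ℕ → ℝ} {v : ℕ → K}
    (hv : InvRadii R v) : InvBound R v := fun j hj => (hv j hj).le

theorem InvBound.update_zero {K : Type*} [NormedField K] {p : ℕ} {R : ℕ → ℝ} {v : ℕ → K}
    (hR : IsRadii p R) (hv : InvBound R v) (q : ℕ) : InvBound R (Function.update v q 0) := by
  intro j hj
  by_cases h : j = q
  · subst h
    simpa using (hR.pos hj).le
  · simpa [h] using hv j hj

theorem InvRadii.update {K : Type*} [NormedField K] {R : ℕ → ℝ} {v : ℕ → K}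
    (hv : InvRadii R v) {q : ℕ} {s : K} (hs : ‖s‖ = (R q)⁻¹) :
    InvRadii R (Function.update v q s) := by
  intro j hj
  by_cases h : j = q
  · subst h
    simpa using hs
  · simpa [h] using hv j hj

section Ultrametric


variable {K : Type*} [NormedField K] [IsUltrametricDist K]

theorem norm_sub_le_max' (x y : K) : ‖x - y‖ ≤ max ‖x‖ ‖y‖ := by
  simpa [sub_eq_add_neg] using IsUltrametricDist.norm_add_le_max x (-y)

theorem norm_add_eq_of_lt {x y : K} (h : ‖y‖ < ‖x‖) : ‖x + y‖ = ‖x‖ := by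
  rw [IsUltrametricDist.norm_add_eq_max_of_norm_ne_norm h.ne', max_eq_left h.le]

theorem norm_eq_of_norm_sub_lt {x y : K} (h : ‖x - y‖ < ‖x‖) : ‖y‖ = ‖x‖ := by
  have := norm_add_eq_of_lt (x := x) (y := y - x) (by rwa [norm_sub_rev])
  simpa using this

theorem norm_sub_trans {x y z : K} {a : ℝ} (h1 : ‖x - y‖ ≤ a) (h2 : ‖y - z‖ ≤ a) :
    ‖x - z‖ ≤ a := by
  rw [← sub_add_sub_cancel x y z]
  exact (IsUltrametricDist.norm_add_le_max _ _).trans (max_le h1 h2)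

theorem norm_mul_sub_mul_le {a b a' b' : K} {M N κ : ℝ} (hM : 0 ≤ M)
    (ha' : ‖a'‖ ≤ M) (hb : ‖b‖ ≤ N) (ha : ‖a - a'‖ ≤ κ * M)
    (hab : ‖b - b'‖ ≤ κ * N) : ‖a * b - a' * b'‖ ≤ κ * (M * N) := by
  have h : a * b - a' * b' = (a - a') * b + a' * (b - b') := by ring
  rw [h]
  refine (IsUltrametricDist.norm_add_le_max _ _).trans (max_le ?_ ?_)
  · rw [norm_mul]
    calc ‖a - a'‖ * ‖b‖ ≤ (κ * M) * N :=
          mul_le_mul ha hb (norm_nonneg _) ((norm_nonneg _).trans ha)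
      _ = _ := by ring
  · rw [norm_mul]
    calc ‖a'‖ * ‖b - b'‖ ≤ M * (κ * N) := mul_le_mul ha' hab (norm_nonneg _) hM
      _ = _ := by ring

theorem norm_prod_sub_prod_le {ι : Type*} (s : Finset ι) {a b : ι → K} {M : ι → ℝ} {κ : ℝ}
    (hκ : 0 ≤ κ) (hM : ∀ i ∈ s, 0 ≤ M i) (ha : ∀ i ∈ s, ‖a i‖ ≤ M i) (hb : ∀ i ∈ s, ‖b i‖ ≤ M i)
    (hab : ∀ i ∈ s, ‖a i - b i‖ ≤ κ * M i) :
    ‖∏ i ∈ s, a i - ∏ i ∈ s, b i‖ ≤ κ * ∏ i ∈ s, M i := by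
  classical
  induction s using Finset.induction_on with
  | empty => simpa using hκ
  | insert i s hi ih =>
    rw [Finset.prod_insert hi, Finset.prod_insert hi, Finset.prod_insert hi]
    simp only [Finset.forall_mem_insert] at hM ha hb hab
    refine norm_mul_sub_mul_le hM.1 hb.1 ?_ hab.1
      (ih hM.2 ha.2 hb.2 hab.2)
    rw [norm_prod]
    exact Finset.prod_le_prod (fun _ _ => norm_nonneg _) ha.2

theorem norm_one_sub_le_max (x : K) {a : ℝ} (hx : ‖x‖ ≤ a) : ‖1 - x‖ ≤ max 1 a :=
  (norm_sub_le_max' _ _).trans (by rw [norm_one]; exact max_le_max le_rfl hx)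

variable {p : ℕ} {R : ℕ → ℝ} {v v' : ℕ → K} {z w : K} {t κ : ℝ}

theorem InvBound.norm_mul_le (hR : IsRadii p R) (hv : InvBound R v) {j : ℕ} (hj : 1 ≤ j)
    (hz : ‖z‖ ≤ t) : ‖v j * z‖ ≤ t / R j := by
  rw [norm_mul, div_eq_inv_mul]
  exact mul_le_mul (hv j hj) hz (norm_nonneg _) (inv_nonneg.2 (hR.pos hj).le)

theorem multipliable_one_sub [CompleteSpace K] (hR : IsRadii p R) (hv : InvBound R v) (z : K) :
    Multipliable fun j : ℕ => 1 - v (j + 1) * z := by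
  set a : ℕ → K := fun j => 1 - v (j + 1) * z with ha
  obtain ⟨J, hJ⟩ := hR.exists_lt ‖z‖
  set C := ‖∏ i ∈ Finset.range J, a i‖ + 1 with hC
  have hC0 : 0 < C := by positivity
  have hle : ∀ j, J ≤ j → ‖v (j + 1) * z‖ ≤ 1 := fun j hj => by
    refine (hv.norm_mul_le hR (by omega) le_rfl).trans ?_
    rw [div_le_one (hR.pos (by omega))]
    exact hJ.le.trans (hR.le (by omega) (by omega))
  have hcauchy : CauchySeq fun s : Finset ℕ => ∏ i ∈ s, a i := by
    rw [Metric.cauchySeq_iff']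
    intro ε hε
    obtain ⟨Q, hQ⟩ := hR.exists_lt (‖z‖ * (2 * C / ε))
    set N := max J Q
    refine ⟨Finset.range N, fun s hs => ?_⟩
    have hsN : Finset.range N ⊆ s := hs
    rw [dist_eq_norm, ← Finset.prod_sdiff hsN]
    have h1 : ‖∏ i ∈ Finset.range N, a i‖ ≤ C := by
      have h2 : Finset.range J ⊆ Finset.range N :=
        Finset.range_subset_range.2 (le_max_left _ _)
      rw [← Finset.prod_sdiff h2, norm_mul]
      have h3 : ‖∏ x ∈ Finset.range N \ Finset.range J, a x‖ ≤ 1 := by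
        rw [norm_prod]
        refine Finset.prod_le_one (fun _ _ => norm_nonneg _) fun i hi => ?_
        simp only [Finset.mem_sdiff, Finset.mem_range, not_lt] at hi
        simpa using norm_one_sub_le_max _ (hle i hi.2)
      calc _ ≤ 1 * ‖∏ i ∈ Finset.range J, a i‖ := by gcongr
        _ ≤ C := by simp [hC]
    have h4 : ‖∏ i ∈ s \ Finset.range N, a i - ∏ i ∈ s \ Finset.range N, (1 : K)‖ ≤
        ε / (2 * C) * ∏ i ∈ s \ Finset.range N, (1 : ℝ) := by
      refine norm_prod_sub_prod_le _ (by positivity) (by simp) (fun i hi => ?_) (by simp)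
        fun i hi => ?_
      · simp only [Finset.mem_sdiff, Finset.mem_range, not_lt] at hi
        simpa using norm_one_sub_le_max _ (hle i ((le_max_left _ _).trans hi.2))
      · simp only [Finset.mem_sdiff, Finset.mem_range, not_lt] at hi
        have h5 : ‖v (i + 1) * z‖ ≤ ‖z‖ / R (i + 1) := hv.norm_mul_le hR (by omega) le_rfl
        have h6 : ‖z‖ * (2 * C / ε) ≤ R (i + 1) :=
          hQ.le.trans (hR.le (by omega) (by have := (le_max_right J Q).trans hi.2; omega))
        have h7 : a i - 1 = -(v (i + 1) * z) := by simp [ha]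
        rw [h7, norm_neg, mul_one]
        refine h5.trans ?_
        rw [div_le_iff₀ (hR.pos (by omega))]
        calc ‖z‖ = ε / (2 * C) * (‖z‖ * (2 * C / ε)) := by field_simp
          _ ≤ _ := by gcongr
    simp only [Finset.prod_const_one, mul_one] at h4
    calc ‖(∏ i ∈ s \ Finset.range N, a i) * ∏ i ∈ Finset.range N, a i -
          ∏ i ∈ Finset.range N, a i‖
        = ‖∏ i ∈ s \ Finset.range N, a i - 1‖ * ‖∏ i ∈ Finset.range N, a i‖ := by
          rw [← norm_mul, sub_mul, one_mul]
      _ ≤ ε / (2 * C) * C := by gcongr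
      _ = ε / 2 := by field_simp
      _ < ε := by linarith
  obtain ⟨P, hP⟩ := cauchySeq_tendsto_of_complete hcauchy
  exact ⟨P, by simpa [HasProd] using hP⟩

variable [CompleteSpace K]

theorem tendsto_gf (hR : IsRadii p R) (hv : InvBound R v) (z : K) :
    Tendsto (fun n => z ^ p / (p : K) * ∏ j ∈ Finset.range n, (1 - v (j + 1) * z)) atTop
      (𝓝 (gf p v z)) :=
  ((multipliable_one_sub hR hv z).hasProd.tendsto_prod_nat).const_mul _

theorem gf_update (hR : IsRadii p R) (hv : InvBound R v) {q : ℕ} (hq : 1 ≤ q) (s z : K) :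
    gf p (Function.update v q s) z = gf p (Function.update v q 0) z * (1 - s * z) := by
  obtain ⟨q, rfl⟩ : ∃ q', q = q' + 1 := ⟨q - 1, by omega⟩
  have h : (fun j : ℕ => 1 - Function.update v (q + 1) s (j + 1) * z) = fun j =>
      (1 - Function.update v (q + 1) 0 (j + 1) * z) * if j = q then 1 - s * z else 1 := by
    funext j
    by_cases hj : j = q
    · simp [hj]
    · simp [hj]
  have hite : HasProd (fun j : ℕ => if j = q then 1 - s * z else 1) (1 - s * z) :=
    hasProd_ite_eq q _
  rw [gf, gf, h,
    (multipliable_one_sub hR (hv.update_zero hR (q + 1)) z).tprod_mul hite.multipliable,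
    hite.tprod_eq, mul_assoc]

theorem gf_eq_mul (hR : IsRadii p R) (hv : InvBound R v) {q : ℕ} (hq : 1 ≤ q) (z : K) :
    gf p v z = gf p (Function.update v q 0) z * (1 - v q * z) := by
  rw [← gf_update hR hv hq, Function.update_eq_self]

variable [hp : Fact p.Prime]

theorem norm_gf_sub_le_of_factors (hR : IsRadii p R) (hpK : ‖(p : K)‖ = (p : ℝ)⁻¹)
    (hv : InvBound R v) (hv' : InvBound R v') (hz : ‖z‖ ≤ t) (hw : ‖w‖ ≤ t) (hκ : 0 ≤ κ)
    (h1 : ‖z ^ p - w ^ p‖ ≤ κ * t ^ p)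
    (h2 : ∀ j, 1 ≤ j → ‖v j * z - v' j * w‖ ≤ κ * max 1 (t / R j)) :
    ‖gf p v z - gf p v' w‖ ≤ κ * phi p R t := by
  have ht : 0 ≤ t := (norm_nonneg z).trans hz
  obtain ⟨J, hJ⟩ := hR.exists_lt t
  have hlim := ((tendsto_gf hR hv z).sub (tendsto_gf hR hv' w)).norm
  refine le_of_tendsto hlim ?_
  filter_upwards [eventually_ge_atTop J] with n hn
  rw [phi_eq hR (hJ.le.trans (hR.le (by omega) (by omega : J + 1 ≤ n + 1)))]
  have hden : ∀ x : K, ‖x / (p : K)‖ = p * ‖x‖ := fun x => by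
    rw [norm_div, hpK, div_inv_eq_mul, mul_comm]
  refine norm_mul_sub_mul_le (by positivity) ?_ ?_ ?_ ?_
  · rw [hden, norm_pow]
    gcongr
  · rw [norm_prod]
    exact Finset.prod_le_prod (fun _ _ => norm_nonneg _) fun i _ =>
      norm_one_sub_le_max _ (hv.norm_mul_le hR (by omega) hz)
  · rw [← sub_div, hden]
    calc (p : ℝ) * ‖z ^ p - w ^ p‖ ≤ p * (κ * t ^ p) := by gcongr
      _ = _ := by ring
  · refine norm_prod_sub_prod_le _ hκ (fun _ _ => by positivity)
      (fun i _ => norm_one_sub_le_max _ (hv.norm_mul_le hR (by omega) hz))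
      (fun i _ => norm_one_sub_le_max _ (hv'.norm_mul_le hR (by omega) hw)) fun i _ => ?_
    rw [sub_sub_sub_cancel_left, norm_sub_rev]
    exact h2 (i + 1) (by omega)

theorem norm_mul_sub_mul_le_max (hR : IsRadii p R) {σ : ℝ} (hv : InvBound R v)
    (hσ : ∀ j, 1 ≤ j → ‖v j - v' j‖ ≤ σ) (hw : ‖w‖ ≤ t) {j : ℕ} (hj : 1 ≤ j) :
    ‖v j * z - v' j * w‖ ≤ max (‖z - w‖ / R j) (t * σ) := by
  have h : v j * z - v' j * w = v j * (z - w) + w * (v j - v' j) := by ring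
  rw [h]
  refine (IsUltrametricDist.norm_add_le_max _ _).trans
    (max_le_max (hv.norm_mul_le hR hj le_rfl) ?_)
  rw [norm_mul]
  exact mul_le_mul hw (hσ j hj) (norm_nonneg _) ((norm_nonneg _).trans hw)

/-- Away from the zeros, `f` does not increase relative distances. -/
theorem norm_gf_sub_le (hR : IsRadii p R) (hpK : ‖(p : K)‖ = (p : ℝ)⁻¹)
    (hv : InvBound R v) (hv' : InvBound R v') {σ : ℝ} (hσ : ∀ j, 1 ≤ j → ‖v j - v' j‖ ≤ σ)
    (hz : ‖z‖ ≤ t) (hw : ‖w‖ ≤ t) (hκ : 0 ≤ κ) (hzw : ‖z - w‖ ≤ κ * t) (hκσ : t * σ ≤ κ) :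
    ‖gf p v z - gf p v' w‖ ≤ κ * phi p R t := by
  have ht : 0 ≤ t := (norm_nonneg z).trans hz
  refine norm_gf_sub_le_of_factors hR hpK hv hv' hz hw hκ ?_ fun j hj => ?_
  · simpa using norm_prod_sub_prod_le (Finset.range p) (a := fun _ => z) (b := fun _ => w)
      (M := fun _ => t) hκ (fun _ _ => ht) (fun _ _ => hz) (fun _ _ => hw) fun _ _ => hzw
  · refine (norm_mul_sub_mul_le_max hR hv hσ hw hj).trans (max_le ?_ ?_)
    · calc ‖z - w‖ / R j ≤ κ * t / R j := by have := hR.pos hj; gcongr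
        _ = κ * (t / R j) := by ring
        _ ≤ _ := by gcongr; exact le_max_right _ _
    · exact hκσ.trans (le_mul_of_one_le_right hκ (le_max_left _ _))

theorem norm_gf_le (hR : IsRadii p R) (hpK : ‖(p : K)‖ = (p : ℝ)⁻¹) (hv : InvBound R v)
    (hz : ‖z‖ ≤ t) : ‖gf p v z‖ ≤ phi p R t := by
  have ht : 0 ≤ t := (norm_nonneg z).trans hz
  have h0 : gf p v (0 : K) = 0 := by simp [gf, hp.out.ne_zero]
  have := norm_gf_sub_le (σ := 0) (w := 0) (κ := 1) hR hpK hv hv (by simp) hz (by simpa using ht)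
    zero_le_one (by simpa using hz) (by simp)
  simpa [h0] using this

theorem norm_gf_eq (hR : IsRadii p R) (hpK : ‖(p : K)‖ = (p : ℝ)⁻¹) (hv : InvBound R v)
    (h : ∀ j, 1 ≤ j → ‖1 - v j * z‖ = max 1 (‖z‖ / R j)) : ‖gf p v z‖ = phi p R ‖z‖ := by
  obtain ⟨J, hJ⟩ := hR.exists_lt ‖z‖
  refine tendsto_nhds_unique (tendsto_gf hR hv z).norm (tendsto_const_nhds.congr' ?_)
  filter_upwards [eventually_ge_atTop J] with n hn
  rw [phi_eq hR (hJ.le.trans (hR.le (by omega) (by omega : J + 1 ≤ n + 1))), norm_mul, norm_div,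
    hpK, norm_pow, norm_prod, div_inv_eq_mul, mul_comm (p : ℝ)]
  congr 1
  exact Finset.prod_congr rfl fun i _ => (h (i + 1) (by omega)).symm

theorem norm_one_sub_eq_of_lt (hR : IsRadii p R) (hv : InvBound R v) {j : ℕ} (hj : 1 ≤ j)
    (h : ‖z‖ < R j) : ‖1 - v j * z‖ = 1 := by
  have h1 : ‖v j * z‖ < 1 :=
    (hv.norm_mul_le hR hj le_rfl).trans_lt ((div_lt_one (hR.pos hj)).2 h)
  rw [sub_eq_add_neg, norm_add_eq_of_lt (by simpa using h1), norm_one]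

theorem norm_one_sub_eq_of_ne (hR : IsRadii p R) (hv : InvRadii R v) {j : ℕ} (hj : 1 ≤ j)
    (h : ‖z‖ ≠ R j) : ‖1 - v j * z‖ = max 1 (‖z‖ / R j) := by
  have h1 : ‖v j * z‖ = ‖z‖ / R j := by rw [norm_mul, hv j hj, div_eq_inv_mul]
  have h2 : ‖z‖ / R j ≠ 1 := fun h2 => h ((div_eq_one_iff_eq (hR.pos hj).ne').1 h2)
  rw [sub_eq_add_neg, IsUltrametricDist.norm_add_eq_max_of_norm_ne_norm, norm_neg, h1, norm_one]
  rw [norm_neg, h1, norm_one]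
  exact h2.symm

theorem norm_gf_eq_of_ne (hR : IsRadii p R) (hpK : ‖(p : K)‖ = (p : ℝ)⁻¹) (hv : InvRadii R v)
    (h : ∀ j, 1 ≤ j → ‖z‖ ≠ R j) : ‖gf p v z‖ = phi p R ‖z‖ :=
  norm_gf_eq hR hpK hv.invBound fun j hj => norm_one_sub_eq_of_ne hR hv hj (h j hj)

/-- Off the `k`-th zero, the norm of `f` on the circle of radius `R_k` is `phi (R_k)`. -/
theorem norm_gf_update_zero (hR : IsRadii p R) (hpK : ‖(p : K)‖ = (p : ℝ)⁻¹) (hv : InvRadii R v)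
    {k : ℕ} (hk : 1 ≤ k) (hz : ‖z‖ = R k) :
    ‖gf p (Function.update v k 0) z‖ = phi p R (R k) := by
  rw [← hz]
  refine norm_gf_eq hR hpK (hv.invBound.update_zero hR k) fun j hj => ?_
  by_cases hjk : j = k
  · subst hjk
    simp [hz, (hR.pos hj).ne']
  · have hne : ‖z‖ ≠ R j := by
      rw [hz]
      rcases lt_or_gt_of_ne hjk with h | h
      · exact (hR.lt hj h).ne'
      · exact (hR.lt hk h).ne
    rw [Function.update_of_ne hjk]
    exact norm_one_sub_eq_of_ne hR hv hj hne

theorem norm_pow_prime_sub_le (hpK : ‖(p : K)‖ = (p : ℝ)⁻¹) (hw : ‖w‖ ≤ t)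
    (hκρ : κ ≤ rho p) (hzw : ‖z - w‖ ≤ κ * t) (hκ : 0 ≤ κ) :
    ‖z ^ p - w ^ p‖ ≤ κ / p * t ^ p := by
  have ht : 0 ≤ t := (norm_nonneg w).trans hw
  have hp0 := prime_pos_real (p := p)
  have hκ1 : κ ≤ 1 := hκρ.trans rho_lt_one.le
  set d := z - w with hd
  have hz : z = d + w := by rw [hd]; ring
  have hsum : z ^ p - w ^ p = d ^ p + p * ∑ k ∈ Finset.Ioo 0 p,
      d ^ k * w ^ (p - k) * ((p.choose k / p : ℕ) : K) := by
    have hterm : ∀ k ∈ Finset.Ioo 0 p, d ^ k * w ^ (p - k) * ((p.choose k / p : ℕ) : K) =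
        d * w * (d ^ (k - 1) * w ^ (p - k - 1) * ((p.choose k / p : ℕ) : K)) := fun k hk => by
      rw [Finset.mem_Ioo] at hk
      rw [← mul_pow_sub_one (by omega : k ≠ 0) d, ← mul_pow_sub_one (by omega : p - k ≠ 0) w]
      ring
    rw [Finset.sum_congr rfl hterm, ← Finset.mul_sum, hz, add_pow_prime_eq hp.out]
    ring
  rw [hsum]
  refine (IsUltrametricDist.norm_add_le_max _ _).trans (max_le ?_ ?_)
  · rw [norm_pow]
    calc ‖d‖ ^ p ≤ (κ * t) ^ p := by gcongr
      _ = κ * κ ^ (p - 1) * t ^ p := by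
        rw [mul_pow, ← pow_succ', Nat.sub_add_cancel hp.out.one_le]
      _ ≤ κ * rho p ^ (p - 1) * t ^ p := by gcongr
      _ = κ / p * t ^ p := by rw [rho_pow, div_eq_mul_inv]
  · rw [norm_mul, hpK]
    have h1 : ‖∑ k ∈ Finset.Ioo 0 p, d ^ k * w ^ (p - k) * ((p.choose k / p : ℕ) : K)‖ ≤
        κ * t ^ p := by
      refine IsUltrametricDist.norm_sum_le_of_forall_le_of_nonneg (by positivity) fun k hk => ?_
      rw [Finset.mem_Ioo] at hk
      have h2 := IsUltrametricDist.norm_natCast_le_one K (p.choose k / p)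
      rw [norm_mul, norm_mul, norm_pow, norm_pow]
      calc ‖d‖ ^ k * ‖w‖ ^ (p - k) * ‖((p.choose k / p : ℕ) : K)‖
          ≤ (κ * t) ^ k * t ^ (p - k) * 1 := by gcongr
        _ = κ ^ k * t ^ p := by
          rw [mul_pow, mul_one, mul_assoc, ← pow_add, Nat.add_sub_cancel' hk.2.le]
        _ ≤ κ * t ^ p := by
          gcongr
          exact pow_le_of_le_one hκ hκ1 (by omega)
    calc (p : ℝ)⁻¹ * _ ≤ (p : ℝ)⁻¹ * (κ * t ^ p) := by gcongr
      _ = _ := by ring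

/-- On the open unit disk, `f` contracts small relative distances by a factor `p`. -/
theorem norm_gf_sub_le_of_lt_one (hR : IsRadii p R) (hpK : ‖(p : K)‖ = (p : ℝ)⁻¹)
    (hv : InvBound R v) (hv' : InvBound R v') {σ κ' : ℝ} (hσ : ∀ j, 1 ≤ j → ‖v j - v' j‖ ≤ σ)
    (hz : ‖z‖ ≤ t) (hw : ‖w‖ ≤ t) (ht1 : t ≤ 1) (hκρ : κ ≤ rho p) (hκ : 0 ≤ κ)
    (hzw : ‖z - w‖ ≤ κ * t) (hκle : κ / p ≤ κ') (hκσ : t * σ ≤ κ') :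
    ‖gf p v z - gf p v' w‖ ≤ κ' * phi p R t := by
  have ht : 0 ≤ t := (norm_nonneg z).trans hz
  have hp0 := prime_pos_real (p := p)
  have hκ'0 : 0 ≤ κ' := le_trans (by positivity) hκle
  refine norm_gf_sub_le_of_factors hR hpK hv hv' hz hw hκ'0 ?_ fun j hj => ?_
  · refine (norm_pow_prime_sub_le hpK hw hκρ hzw hκ).trans ?_
    gcongr
  · refine (norm_mul_sub_mul_le_max hR hv hσ hw hj).trans
      (le_trans (max_le ?_ hκσ) (le_mul_of_one_le_right hκ'0 (le_max_left _ _)))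
    calc ‖z - w‖ / R j ≤ κ * 1 / p := by
          have := hR.prime_lt hj
          gcongr
          exact hzw.trans (by gcongr)
      _ = κ / p := by rw [mul_one]
      _ ≤ κ' := hκle

/-- On the disk `B_k`, `f` multiplies distances by `lam k`. -/
theorem norm_gf_sub_eq (hR : IsRadii p R) (hpK : ‖(p : K)‖ = (p : ℝ)⁻¹) (hv : InvRadii R v)
    {k : ℕ} (hk : 1 ≤ k) (hz : ‖1 - v k * z‖ < 1) (hzR : ‖z‖ = R k) (hwR : ‖w‖ = R k) :
    ‖gf p v z - gf p v w‖ = lam p R k * ‖z - w‖ := by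
  have hRk := hR.pos hk
  have hφ := phi_pos hR hRk
  rcases eq_or_ne z w with rfl | hne
  · simp
  have hzw : 0 < ‖z - w‖ := norm_pos_iff.2 (sub_ne_zero.2 hne)
  set G := gf p (Function.update v k 0) with hG
  have hGw : ‖G w‖ = phi p R (R k) := norm_gf_update_zero hR hpK hv hk hwR
  have hGsub : ‖G z - G w‖ ≤ ‖z - w‖ / R k * phi p R (R k) :=
    norm_gf_sub_le (σ := 0) hR hpK (hv.invBound.update_zero hR k) (hv.invBound.update_zero hR k)
      (by simp) hzR.le hwR.le (by positivity) (by field_simp; exact le_rfl)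
      (by rw [mul_zero]; positivity)
  have hsplit : gf p v z - gf p v w =
      -(G w * v k * (z - w)) + (G z - G w) * (1 - v k * z) := by
    rw [gf_eq_mul hR hv.invBound hk z, gf_eq_mul hR hv.invBound hk w]
    ring
  have hmain : ‖-(G w * v k * (z - w))‖ = lam p R k * ‖z - w‖ := by
    rw [norm_neg, norm_mul, norm_mul, hGw, hv k hk, lam, div_eq_mul_inv]
  rw [hsplit, norm_add_eq_of_lt, hmain]
  rw [hmain, norm_mul]
  calc ‖G z - G w‖ * ‖1 - v k * z‖ ≤ ‖z - w‖ / R k * phi p R (R k) * ‖1 - v k * z‖ := by gcongr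
    _ < ‖z - w‖ / R k * phi p R (R k) * 1 := by gcongr
    _ = _ := by rw [lam]; ring

/-- Effect on `f` at a point of `B_k` of moving the zeros other than the `k`-th one. -/
theorem norm_gf_sub_le_param (hR : IsRadii p R) (hpK : ‖(p : K)‖ = (p : ℝ)⁻¹)
    (hv : InvRadii R v) (hv' : InvRadii R v') {σ : ℝ} (hσ : ∀ j, 1 ≤ j → ‖v j - v' j‖ ≤ σ)
    {k : ℕ} (hk : 1 ≤ k) (hkk : v k = v' k) (hz : ‖z‖ = R k) :
    ‖gf p v z - gf p v' z‖ ≤ R k * σ * ‖gf p v z‖ := by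
  have hRk := hR.pos hk
  have hσ0 : 0 ≤ σ := (norm_nonneg _).trans (hσ 1 le_rfl)
  rw [gf_eq_mul hR hv.invBound hk z, gf_eq_mul hR hv'.invBound hk z, ← hkk, ← sub_mul, norm_mul,
    norm_mul, norm_gf_update_zero hR hpK hv hk hz, ← mul_assoc]
  gcongr
  refine norm_gf_sub_le (σ := σ) hR hpK (hv.invBound.update_zero hR k)
    (hv'.invBound.update_zero hR k) (fun j hj => ?_) hz.le hz.le (by positivity) ?_ le_rfl
  · by_cases h : j = k
    · simpa [h] using hσ0
    · simpa [h] using hσ j hj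
  · rw [sub_self, norm_zero]
    positivity

theorem norm_eq_of_norm_one_sub_lt (hR : IsRadii p R) (hv : InvRadii R v) {k : ℕ} (hk : 1 ≤ k)
    (hz : ‖1 - v k * z‖ < 1) : ‖z‖ = R k := by
  have h := norm_eq_of_norm_sub_lt (x := (1 : K)) (y := v k * z) (by simpa using hz)
  rw [norm_mul, hv k hk, norm_one] at h
  have := hR.pos hk
  field_simp at h
  exact h

theorem norm_one_sub_lt_of_norm_sub_lt (hR : IsRadii p R) (hv : InvRadii R v) {k : ℕ} (hk : 1 ≤ k)
    (hz : ‖1 - v k * z‖ < 1) (hzw : ‖z - w‖ < R k) : ‖1 - v k * w‖ < 1 := by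
  have h : 1 - v k * w = (1 - v k * z) + v k * (z - w) := by ring
  rw [h]
  refine (IsUltrametricDist.norm_add_le_max _ _).trans_lt (max_lt hz ?_)
  rw [norm_mul, hv k hk, ← div_eq_inv_mul]
  exact (div_lt_one (hR.pos hk)).2 hzw

end Ultrametric

/-! ### Numerical data attached to the blocks of the itinerary -/

/-- `r` is the radius whose orbit under `phi` stays `m` steps below `1`, then `n` steps above `1`
off all critical radii, and then lands on `R k`. -/
structure IsEntry (p : ℕ) (R : ℕ → ℝ) (k m n : ℕ) (r : ℝ) : Prop where
  rho_lt : rho p < r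
  iter_lt_one : ∀ i < m, (phi p R)^[i] r < 1
  one_le_iter : ∀ i, m ≤ i → 1 ≤ (phi p R)^[i] r
  iter_eq : (phi p R)^[m + n] r = R k
  iter_ne : ∀ i < m + n, ∀ j, 1 ≤ j → (phi p R)^[i] r ≠ R j

section Entry

variable {p : ℕ} [hp : Fact p.Prime] {R : ℕ → ℝ}

theorem isEntry_of_iterate_eq (hR : IsGenericRadii p R) {k m : ℕ} (hk : 1 ≤ k) (hm : 1 ≤ m) {r : ℝ}
    (hr0 : 0 < r) (hr : (phi p R)^[m + nseq p R k] r = R k) :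
    IsEntry p R k m (nseq p R k) r := by
  obtain ⟨hn, hn1, hn2⟩ := nseq_spec hR.1 hk
  set n := nseq p R k
  have hpos := fun i => phi_iterate_pos hR.1 hr0 i
  rw [add_comm, Function.iterate_add_apply] at hr
  have h1 : 1 ≤ (phi p R)^[m] r := by
    by_contra! h
    exact absurd (phi_iterate_lt hR.1 (hpos m) h n) (by rw [hr]; exact hn1.not_gt)
  have h2 : (phi p R)^[m] r < p := by
    by_contra! h
    rw [Function.iterate_succ_apply, phi_one hR.1] at hn2
    rcases h.eq_or_lt with h | h
    · rw [h, hr] at hn2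
      exact hn2.false
    · have := phi_iterate_lt hR.1 prime_pos_real h n
      rw [hr] at this
      exact hn2.asymm this
  have hrho : rho p < r := by
    by_contra! h
    have : ∀ i, (phi p R)^[i] r ≤ rho p := fun i => by
      induction i with
      | zero => exact h
      | succ i ih =>
        rw [Function.iterate_succ_apply', ← phi_rho hR.1]
        exact phi_le_phi hR.1 (hpos i) ih
    exact absurd (h1.trans (this m)) rho_lt_one.not_ge
  have hmono := phi_iterate_strictMono hR.1 hrho
  have h3 : (phi p R)^[m - 1] r < 1 := by
    by_contra! h
    have h4 := phi_le_phi hR.1 one_pos h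
    rw [← Function.iterate_succ_apply' (phi p R), phi_one hR.1,
      show (m - 1).succ = m by omega] at h4
    exact h2.not_ge h4
  rw [← Function.iterate_add_apply, add_comm] at hr
  refine ⟨hrho, fun i hi => (hmono.monotone (by omega : i ≤ m - 1)).trans_lt h3,
    fun i hi => h1.trans (hmono.monotone hi), hr, fun i hi j hj h => ?_⟩
  have hlt : R j < R k := by
    rw [← h, ← hr]
    exact hmono hi
  have hjk : j < k := by
    by_contra! hkj
    exact hlt.not_ge (hR.1.le hk hkj)
  refine hR.2 j k (m + n - i) hj hjk (by omega) ?_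
  rw [← h, ← Function.iterate_add_apply, show m + n - i + i = m + n by omega, hr]

theorem exists_isEntry (hR : IsGenericRadii p R) {k m : ℕ} (hk : 1 ≤ k) (hm : 1 ≤ m) :
    ∃ r, IsEntry p R k m (nseq p R k) r := by
  obtain ⟨r, hr0, hr⟩ := exists_phi_iterate_eq hR.1 (m + nseq p R k) (hR.1.pos hk)
  exact ⟨r, isEntry_of_iterate_eq hR hk hm hr0 hr⟩

theorem phi_Sse (hR : IsRadii p R) {k : ℕ} (hk : 1 ≤ k) : phi p R (Sse p R k) = R k := by
  obtain ⟨t, -, ht⟩ := exists_phi_eq hR (hR.pos hk)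
  exact Function.invFun_eq ⟨t, ht⟩

theorem IsEntry.pos {k m n : ℕ} {r : ℝ} (h : IsEntry p R k m n r) : 0 < r := rho_pos.trans h.rho_lt

theorem continuous_phi_iterate (hR : IsRadii p R) (i : ℕ) : Continuous ((phi p R)^[i]) :=
  (phi_continuous hR).iterate i

/-- Slightly larger radii still avoid the critical radii. -/
theorem IsEntry.exists_gt (hR : IsRadii p R) {k m n : ℕ} {r : ℝ} (hk : 1 ≤ k)
    (h : IsEntry p R k m n r) :
    ∃ r₁ > r, ∀ s, r ≤ s → s ≤ r₁ → ∀ i < m + n, ∀ j, 1 ≤ j → (phi p R)^[i] s ≠ R j := by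
  have hev : ∀ᶠ s in 𝓝 r, ∀ i ∈ Finset.range (m + n), ∀ j ∈ Finset.range (k + 1), 1 ≤ j →
      (phi p R)^[i] s ≠ R j ∧ (phi p R)^[i] s < R k := by
    rw [Filter.eventually_all_finset]
    intro i hi
    rw [Filter.eventually_all_finset]
    intro j _
    rw [Filter.eventually_imp_distrib_left]
    intro hj
    have hlt : (phi p R)^[i] r < R k := by
      rw [← h.iter_eq]
      exact phi_iterate_strictMono hR h.rho_lt (Finset.mem_range.1 hi)
    exact ((continuous_phi_iterate hR i).continuousAt.eventually_ne
      (h.iter_ne i (Finset.mem_range.1 hi) j hj)).and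
      ((continuous_phi_iterate hR i).continuousAt.eventually_lt_const hlt)
  obtain ⟨η, hη, hball⟩ := Metric.eventually_nhds_iff.1 hev
  refine ⟨r + η / 2, by simpa using hη, fun s hs hs1 i hi j hj heq => ?_⟩
  have hd : dist s r < η := by
    rw [Real.dist_eq, abs_of_nonneg (by linarith)]
    linarith
  have h1 := hball hd i (Finset.mem_range.2 hi)
  by_cases hjk : j ≤ k
  · exact (h1 j (Finset.mem_range.2 (by omega)) hj).1 heq
  · have h2 := (h1 k (Finset.mem_range.2 (by omega)) hk).2
    rw [heq] at h2
    exact h2.not_ge (hR.le hk (by omega))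

end Entry

/-- The factor by which a change of the parameter of index `k` displaces the orbit at the start of
the `k`-th block. -/
def expFactor (p : ℕ) (R : ℕ → ℝ) (l : ℕ → ℕ) (k : ℕ) : ℝ :=
  if k ≤ 1 then 0 else R (k - 1) * Sse p R (k - 1) * lam p R (k - 1) ^ l k

/-- The size of the parameter disk explored when adjusting the parameter of index `k + 1`. -/
def paramRadius (p : ℕ) (R : ℕ → ℝ) (l : ℕ → ℕ) (k : ℕ) : ℝ :=
  p / (Sse p R k * lam p R k ^ l (k + 1))

/-- The numerical hypotheses on radii and block lengths used in the dynamical argument. -/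
structure Admissible (p : ℕ) (R : ℕ → ℝ) (m l : ℕ → ℕ) (r : ℕ → ℝ) : Prop where
  radii : IsRadii p R
  entry : ∀ k, 1 ≤ k → IsEntry p R k (m k) (nseq p R k) (r k)
  one_le_m : ∀ k, 1 ≤ k → 1 ≤ m k
  one_le_n : ∀ k, 1 ≤ k → 1 ≤ nseq p R k
  one_le_l : ∀ k, 2 ≤ k → 1 ≤ l k
  iter_eq_Sse : ∀ k, 1 ≤ k → (phi p R)^[m k + nseq p R k - 1] (r k) = Sse p R k
  mul_lam_pow_lt : ∀ k, 1 ≤ k → R k * lam p R k ^ l (k + 1) < rho p * p ^ m k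
  expFactor_lt : ∀ k, 1 ≤ k → expFactor p R l k < rho p ^ 2 * p ^ m k
  paramRadius_mul_lt : ∀ k, 1 ≤ k → paramRadius p R l k * R (k + 1) < rho p
  expFactor_mul_le : ∀ j k, 1 ≤ j → j ≤ k → expFactor p R l j * paramRadius p R l k ≤ rho p ^ 2

section Numbers

variable {p : ℕ} [hp : Fact p.Prime] {R ε r : ℕ → ℝ} {m l : ℕ → ℕ}

theorem lam_pos (hR : IsRadii p R) {k : ℕ} (hk : 1 ≤ k) : 0 < lam p R k :=
  div_pos (phi_pos hR (hR.pos hk)) (hR.pos hk)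

theorem lam_mul (hR : IsRadii p R) {k : ℕ} (hk : 1 ≤ k) : lam p R k * R k = phi p R (R k) :=
  div_mul_cancel₀ _ (hR.pos hk).ne'

theorem one_lt_radius (hR : IsRadii p R) {k : ℕ} (hk : 1 ≤ k) : 1 < R k := by
  have h1 := hR.prime_lt hk
  have h2 := two_le_prime_real (p := p)
  linarith

theorem prime_lt_lam (hR : IsRadii p R) {k : ℕ} (hk : 1 ≤ k) : (p : ℝ) < lam p R k := by
  have h1 := phi_mul_lt hR one_pos (one_lt_radius hR hk)
  rw [phi_one hR, mul_one, ← lam_mul hR hk] at h1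
  exact lt_of_mul_lt_mul_right h1 (hR.pos hk).le

theorem one_lt_lam (hR : IsRadii p R) {k : ℕ} (hk : 1 ≤ k) : 1 < lam p R k := by
  have h1 := prime_lt_lam hR hk
  have h2 := two_le_prime_real (p := p)
  linarith

theorem Sse_pos_of_cond33 (hR : IsRadii p R) {k : ℕ} (hk : 1 ≤ k)
    (hε : 0 < ε (k + 2)) (h33 : Cond33 p R ε l (k + 2)) : 0 < Sse p R k := by
  have h := hε.trans (h33 (k + 1) (by omega) (by omega))
  rw [Nat.add_sub_cancel] at h
  by_contra! hS
  have h0 := lam_pos hR hk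
  have h1 := hR.pos hk
  have h2 := rho_pos (p := p)
  have h3 : (R k * Sse p R k)⁻¹ ≤ 0 := inv_nonpos.2 (mul_nonpos_of_nonneg_of_nonpos h1.le hS)
  refine h.not_ge (mul_nonpos_of_nonpos_of_nonneg
    (mul_nonpos_of_nonneg_of_nonpos (by positivity) h3) (by positivity))

theorem paramRadius_mul_sq_lt (hR : IsRadii p R) {k : ℕ} (hk : 1 ≤ k) (hS : 0 < Sse p R k)
    (h35 : Cond35 p R ε l k) :
    paramRadius p R l k * R (k + 1) ^ 2 < rho p * ε (k + 1) := by
  have h0 := rho_pos (p := p)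
  have h1 := lam_pos hR hk
  have h2 := mul_lt_mul_of_pos_left h35 h0
  refine lt_of_eq_of_lt ?_ h2
  rw [paramRadius]
  field_simp

theorem exists_admissible (hR : IsGenericRadii p R)
    (hε : ∀ j, 2 ≤ j → 0 < ε j ∧ ε j < R j)
    (hm : ∀ j, 1 ≤ j → 1 ≤ m j) (hl : ∀ j, 2 ≤ j → 1 ≤ l j)
    (h32 : ∀ k, 1 ≤ k → Cond32 p R m l k)
    (h33 : ∀ k, 1 ≤ k → Cond33 p R ε l k)
    (h34 : ∀ k, 1 ≤ k → Cond34 p R m l k)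
    (h35 : ∀ k, 1 ≤ k → Cond35 p R ε l k) :
    ∃ r, Admissible p R m l r := by
  have hex : ∀ k, ∃ r, 1 ≤ k → IsEntry p R k (m k) (nseq p R k) r := fun k => by
    by_cases hk : 1 ≤ k
    · obtain ⟨r, hr⟩ := exists_isEntry hR hk (hm k hk)
      exact ⟨r, fun _ => hr⟩
    · exact ⟨0, fun h => absurd h hk⟩
  choose r hr using hex
  have hS : ∀ k, 1 ≤ k → 0 < Sse p R k := fun k hk =>
    Sse_pos_of_cond33 hR.1 hk (hε _ (by omega)).1 (h33 _ (by omega))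
  have hρ := rho_pos (p := p)
  have hp0 := prime_pos_real (p := p)
  have hpr := fun k (hk : 1 ≤ k) => paramRadius_mul_sq_lt hR.1 hk (hS k hk) (h35 k hk)
  refine ⟨r, hR.1, hr, hm, fun k hk => (nseq_spec hR.1 hk).1, hl, fun k hk => ?_, fun k hk => ?_,
    fun k hk => ?_, fun k hk => ?_, fun j k hj hjk => ?_⟩
  · refine phi_inj hR.1 (phi_iterate_pos hR.1 (hr k hk).pos _) (hS k hk) ?_
    rw [phi_Sse hR.1 hk, ← Function.iterate_succ_apply' (phi p R), ← (hr k hk).iter_eq]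
    have := hm k hk
    congr 1
    omega
  · have h := h32 k hk
    rw [Cond32] at h
    have h2 : (0 : ℝ) < p ^ m k := by positivity
    rw [← sub_pos] at h ⊢
    have h3 := mul_pos (mul_pos hρ h2) h
    refine lt_of_lt_of_eq h3 ?_
    field_simp
  · rw [expFactor]
    split_ifs with hk1
    · positivity
    · have h := h34 k hk k (by omega) le_rfl
      have h2 : (0 : ℝ) < p ^ m k := by positivity
      rw [← sub_pos] at h ⊢
      have h3 := mul_pos (mul_pos (pow_pos hρ 2) h2) h
      refine lt_of_lt_of_eq h3 ?_
      field_simp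
  · have h1 := hpr k hk
    have h2 := mul_lt_mul_of_pos_left (hε (k + 1) (by omega)).2 hρ
    have h3 := h1.trans h2
    rw [sq, ← mul_assoc] at h3
    exact lt_of_mul_lt_mul_right h3 (hR.1.pos (by omega)).le
  · have hk : 1 ≤ k := hj.trans hjk
    rw [expFactor]
    split_ifs with hj1
    · rw [zero_mul]
      positivity
    · have h1 := hpr k hk
      have h2 := h33 (k + 1) (by omega) j (by omega) (by omega)
      have hRk := hR.1.pos (by omega : 1 ≤ k + 1)
      have hRj := hR.1.pos (by omega : 1 ≤ j - 1)
      have hSj := hS (j - 1) (by omega)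
      have hlj := lam_pos hR.1 (by omega : 1 ≤ j - 1)
      have h3 := h1.trans (mul_lt_mul_of_pos_left h2 hρ)
      have h4 : paramRadius p R l k <
          rho p ^ (k + 2 - j) / (R (j - 1) * Sse p R (j - 1) * lam p R (j - 1) ^ l j) := by
        refine lt_of_mul_lt_mul_right (lt_of_lt_of_eq h3 ?_) (sq_nonneg (R (k + 1)))
        rw [show k + 2 - j = k + 1 - j + 1 by omega, pow_succ]
        field_simp
        ring
      rw [lt_div_iff₀ (by positivity), mul_comm] at h4
      exact h4.le.trans (pow_le_pow_of_le_one hρ.le rho_lt_one.le (by omega))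

namespace Admissible

theorem one_le_Sse (hA : Admissible p R m l r) {k : ℕ} (hk : 1 ≤ k) : 1 ≤ Sse p R k := by
  rw [← hA.iter_eq_Sse k hk]
  have := hA.one_le_n k hk
  exact (hA.entry k hk).one_le_iter _ (by omega)

theorem Sse_lt (hA : Admissible p R m l r) {k : ℕ} (hk : 1 ≤ k) : Sse p R k < R k := by
  rw [← hA.iter_eq_Sse k hk, ← (hA.entry k hk).iter_eq]
  have := hA.one_le_n k hk
  exact phi_iterate_strictMono hA.radii (hA.entry k hk).rho_lt (by omega)

theorem Sse_pos (hA : Admissible p R m l r) {k : ℕ} (hk : 1 ≤ k) : 0 < Sse p R k :=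
  one_pos.trans_le (hA.one_le_Sse hk)

theorem radius_lt_lam_mul_Sse (hA : Admissible p R m l r) {k : ℕ} (hk : 1 ≤ k) :
    R k < lam p R k * Sse p R k := by
  have h := phi_mul_lt hA.radii (hA.Sse_pos hk) (hA.Sse_lt hk)
  rw [phi_Sse hA.radii hk, ← lam_mul hA.radii hk] at h
  refine lt_of_mul_lt_mul_right (lt_of_lt_of_eq h ?_) (hA.radii.pos hk).le
  ring

theorem paramRadius_pos (hA : Admissible p R m l r) {k : ℕ} (hk : 1 ≤ k) :
    0 < paramRadius p R l k :=
  div_pos prime_pos_real (mul_pos (hA.Sse_pos hk) (pow_pos (lam_pos hA.radii hk) _))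

theorem Sse_mul_paramRadius (hA : Admissible p R m l r) {k : ℕ} (hk : 1 ≤ k) :
    Sse p R k * lam p R k ^ l (k + 1) * paramRadius p R l k = p := by
  have h1 := hA.Sse_pos hk
  have h2 := lam_pos hA.radii hk
  rw [paramRadius]
  field_simp

theorem expFactor_succ {k : ℕ} (hk : 1 ≤ k) :
    expFactor p R l (k + 1) = R k * Sse p R k * lam p R k ^ l (k + 1) := by
  rw [expFactor, if_neg (by omega), Nat.add_sub_cancel]

theorem expFactor_succ_mul (hA : Admissible p R m l r) {k : ℕ} (hk : 1 ≤ k) :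
    expFactor p R l (k + 1) * paramRadius p R l k = p * R k := by
  rw [expFactor_succ hk, ← hA.Sse_mul_paramRadius hk]
  ring

theorem expFactor_succ_pos (hA : Admissible p R m l r) {k : ℕ} (hk : 1 ≤ k) :
    0 < expFactor p R l (k + 1) := by
  have h1 := hA.Sse_pos hk
  have h2 := lam_pos hA.radii hk
  have h3 := hA.radii.pos hk
  rw [expFactor_succ hk]
  positivity

theorem expFactor_nonneg (hA : Admissible p R m l r) {k : ℕ} (hk : 1 ≤ k) :
    0 ≤ expFactor p R l k := by
  obtain ⟨_ | k, rfl⟩ := Nat.exists_eq_add_of_le' hk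
  · simp [expFactor]
  · exact (hA.expFactor_succ_pos (by omega)).le

theorem paramRadius_lt_rho (hA : Admissible p R m l r) {k : ℕ} (hk : 1 ≤ k) :
    paramRadius p R l k < rho p := by
  have h1 := hA.paramRadius_mul_lt k hk
  have h2 := one_lt_radius hA.radii (by omega : 1 ≤ k + 1)
  have h3 := hA.paramRadius_pos hk
  nlinarith

theorem paramRadius_lt_inv (hA : Admissible p R m l r) {k : ℕ} (hk : 1 ≤ k) :
    paramRadius p R l k < (R (k + 1))⁻¹ := by
  rw [← one_div, lt_div_iff₀ (hA.radii.pos (by omega))]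
  exact (hA.paramRadius_mul_lt k hk).trans rho_lt_one

theorem prime_mul_radius_lt (hA : Admissible p R m l r) {k : ℕ} (hk : 1 ≤ k) :
    p * R k < Sse p R k * lam p R k ^ l (k + 1) := by
  have h1 := hA.Sse_mul_paramRadius hk
  have h2 := hA.paramRadius_lt_inv hk
  have h3 := hA.radii.lt hk (Nat.lt_succ_self k)
  have h4 : paramRadius p R l k * R k < 1 := by
    calc paramRadius p R l k * R k ≤ paramRadius p R l k * R (k + 1) := by
          have := hA.paramRadius_pos hk
          gcongr
      _ < 1 := (hA.paramRadius_mul_lt k hk).trans rho_lt_one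
  have h5 : 0 < Sse p R k * lam p R k ^ l (k + 1) :=
    mul_pos (hA.Sse_pos hk) (pow_pos (lam_pos hA.radii hk) _)
  rw [← h1, mul_assoc]
  exact mul_lt_of_lt_one_right h5 h4

theorem paramRadius_anti (hA : Admissible p R m l r) {k k' : ℕ} (hk : 1 ≤ k) (hkk' : k ≤ k') :
    paramRadius p R l k' ≤ paramRadius p R l k := by
  induction k', hkk' using Nat.le_induction with
  | base => exact le_rfl
  | succ n hn ih =>
    refine le_trans ?_ ih
    have hn1 : 1 ≤ n := hk.trans hn
    have h1 := hA.expFactor_mul_le (n + 1) (n + 1) (by omega) le_rfl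
    have h2 := hA.expFactor_succ_mul hn1
    refine le_of_mul_le_mul_left (h1.trans ?_) (hA.expFactor_succ_pos hn1)
    rw [h2]
    have h3 := two_le_prime_real (p := p)
    have h4 := one_lt_radius hA.radii hn1
    have h5 := pow_le_one₀ (n := 2) (rho_pos (p := p)).le rho_lt_one.le
    nlinarith

end Admissible

end Numbers

/-! ### Uniform limits of polynomials and their small values -/

/-- `h` is a uniform limit of polynomials on `D`. -/
def IsPolyLimit {K : Type*} [NormedField K] (D : Set K) (h : K → K) : Prop :=
  ∀ δ > (0 : ℝ), ∃ P : Polynomial K, ∀ s ∈ D, ‖h s - P.eval s‖ < δ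

section PolyLimit

variable {K : Type*} [NormedField K] {D : Set K} {h g : K → K}

theorem IsPolyLimit.polynomial (P : Polynomial K) : IsPolyLimit D fun s => P.eval s :=
  fun δ hδ => ⟨P, fun s _ => by simpa using hδ⟩

theorem IsPolyLimit.const (a : K) : IsPolyLimit D fun _ => a := by
  simpa using IsPolyLimit.polynomial (D := D) (Polynomial.C a)

theorem IsPolyLimit.id : IsPolyLimit D fun s => s := by
  simpa using IsPolyLimit.polynomial (D := D) Polynomial.X

theorem IsPolyLimit.of_forall_exists
    (H : ∀ δ > (0 : ℝ), ∃ g, IsPolyLimit D g ∧ ∀ s ∈ D, ‖h s - g s‖ < δ) : IsPolyLimit D h := by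
  intro δ hδ
  obtain ⟨g, hg, hgδ⟩ := H (δ / 2) (half_pos hδ)
  obtain ⟨P, hP⟩ := hg (δ / 2) (half_pos hδ)
  refine ⟨P, fun s hs => ?_⟩
  calc ‖h s - P.eval s‖ ≤ ‖h s - g s‖ + ‖g s - P.eval s‖ := norm_sub_le_norm_sub_add_norm_sub _ _ _
    _ < δ / 2 + δ / 2 := add_lt_add (hgδ s hs) (hP s hs)
    _ = δ := add_halves δ

theorem IsPolyLimit.congr (hh : IsPolyLimit D h) (H : ∀ s ∈ D, g s = h s) : IsPolyLimit D g :=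
  .of_forall_exists fun δ hδ => ⟨h, hh, fun s hs => by simpa [H s hs] using hδ⟩

theorem IsPolyLimit.add (hh : IsPolyLimit D h) (hg : IsPolyLimit D g) :
    IsPolyLimit D fun s => h s + g s := by
  intro δ hδ
  obtain ⟨P, hP⟩ := hh (δ / 2) (half_pos hδ)
  obtain ⟨Q, hQ⟩ := hg (δ / 2) (half_pos hδ)
  refine ⟨P + Q, fun s hs => ?_⟩
  rw [Polynomial.eval_add, add_sub_add_comm]
  exact (norm_add_le _ _).trans_lt
    ((add_lt_add (hP s hs) (hQ s hs)).trans_eq (add_halves δ))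

theorem exists_norm_eval_le (hD : Bornology.IsBounded D) (P : Polynomial K) :
    ∃ B > 0, ∀ s ∈ D, ‖P.eval s‖ ≤ B := by
  obtain ⟨b, hb0, hb⟩ := hD.exists_pos_norm_le
  induction P using Polynomial.induction_on' with
  | add P Q hP hQ =>
    obtain ⟨B, hB0, hB⟩ := hP
    obtain ⟨B', hB0', hB'⟩ := hQ
    refine ⟨B + B', add_pos hB0 hB0', fun s hs => ?_⟩
    rw [Polynomial.eval_add]
    exact (norm_add_le _ _).trans (add_le_add (hB s hs) (hB' s hs))
  | monomial n a =>
    refine ⟨‖a‖ * b ^ n + 1, by positivity, fun s hs => ?_⟩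
    rw [Polynomial.eval_monomial, norm_mul, norm_pow]
    have := pow_le_pow_left₀ (norm_nonneg s) (hb s hs) n
    nlinarith [norm_nonneg a]

theorem IsPolyLimit.exists_norm_le (hD : Bornology.IsBounded D) (hh : IsPolyLimit D h) :
    ∃ B > 0, ∀ s ∈ D, ‖h s‖ ≤ B := by
  obtain ⟨P, hP⟩ := hh 1 one_pos
  obtain ⟨B, hB0, hB⟩ := exists_norm_eval_le hD P
  refine ⟨1 + B, by positivity, fun s hs => ?_⟩
  calc ‖h s‖ = ‖(h s - P.eval s) + P.eval s‖ := by rw [sub_add_cancel]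
    _ ≤ 1 + B := (norm_add_le _ _).trans (add_le_add (hP s hs).le (hB s hs))

theorem IsPolyLimit.mul (hD : Bornology.IsBounded D) (hh : IsPolyLimit D h)
    (hg : IsPolyLimit D g) : IsPolyLimit D fun s => h s * g s := by
  intro δ hδ
  obtain ⟨B, hB0, hB⟩ := hg.exists_norm_le hD
  obtain ⟨P, hP⟩ := hh (δ / 2 / B) (by positivity)
  obtain ⟨B', hB0', hB'⟩ := exists_norm_eval_le hD P
  obtain ⟨Q, hQ⟩ := hg (δ / 2 / B') (by positivity)
  refine ⟨P * Q, fun s hs => ?_⟩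
  rw [Polynomial.eval_mul, show h s * g s - P.eval s * Q.eval s =
    (h s - P.eval s) * g s + P.eval s * (g s - Q.eval s) by ring]
  refine (norm_add_le _ _).trans_lt (lt_of_lt_of_eq (add_lt_add_of_le_of_lt (b := δ / 2)
    (d := δ / 2) ?_ ?_) (add_halves δ))
  · rw [norm_mul]
    calc _ ≤ δ / 2 / B * B := mul_le_mul (hP s hs).le (hB s hs) (norm_nonneg _) (by positivity)
      _ = δ / 2 := by field_simp
  · rw [norm_mul]
    calc _ ≤ B' * ‖g s - Q.eval s‖ := mul_le_mul_of_nonneg_right (hB' s hs) (norm_nonneg _)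
      _ < B' * (δ / 2 / B') := mul_lt_mul_of_pos_left (hQ s hs) hB0'
      _ = δ / 2 := by field_simp

theorem IsPolyLimit.sub (hD : Bornology.IsBounded D) (hh : IsPolyLimit D h)
    (hg : IsPolyLimit D g) : IsPolyLimit D fun s => h s - g s :=
  (hh.add ((IsPolyLimit.const (-1)).mul hD hg)).congr fun s _ => by ring

theorem IsPolyLimit.pow (hD : Bornology.IsBounded D) (hh : IsPolyLimit D h) (n : ℕ) :
    IsPolyLimit D fun s => h s ^ n := by
  induction n with
  | zero => simpa using IsPolyLimit.const 1
  | succ n ih => simpa only [pow_succ] using ih.mul hD hh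

theorem IsPolyLimit.finset_sum {ι : Type*} (S : Finset ι) {u : ι → K → K}
    (hu : ∀ i ∈ S, IsPolyLimit D (u i)) : IsPolyLimit D fun s => ∑ i ∈ S, u i s := by
  classical
  induction S using Finset.induction_on with
  | empty => simpa using IsPolyLimit.const 0
  | insert a S ha ih =>
    simp only [Finset.sum_insert ha]
    exact (hu a (by simp)).add (ih fun i hi => hu i (by simp [hi]))

theorem IsPolyLimit.finset_prod (hD : Bornology.IsBounded D) {ι : Type*} (S : Finset ι)
    {u : ι → K → K} (hu : ∀ i ∈ S, IsPolyLimit D (u i)) :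
    IsPolyLimit D fun s => ∏ i ∈ S, u i s := by
  classical
  induction S using Finset.induction_on with
  | empty => simpa using IsPolyLimit.const 1
  | insert a S ha ih =>
    simp only [Finset.prod_insert ha]
    exact (hu a (by simp)).mul hD (ih fun i hi => hu i (by simp [hi]))

theorem IsPolyLimit.inv [IsUltrametricDist K] (hD : Bornology.IsBounded D)
    (hh : IsPolyLimit D h) {a : K} (ha : a ≠ 0) {θ : ℝ} (hθ : θ < 1)
    (H : ∀ s ∈ D, ‖a - h s‖ ≤ θ * ‖a‖) : IsPolyLimit D fun s => (h s)⁻¹ := by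
  have ha0 : 0 < ‖a‖ := norm_pos_iff.2 ha
  refine .of_forall_exists fun δ hδ => ?_
  obtain ⟨n, hn⟩ := exists_pow_lt_of_lt_one (mul_pos ha0 hδ) hθ
  refine ⟨fun s => a⁻¹ * ∑ i ∈ Finset.range n, ((a - h s) * a⁻¹) ^ i, (IsPolyLimit.const _).mul hD
    (.finset_sum _ fun i _ => (((IsPolyLimit.const a).sub hD hh).mul hD (.const _)).pow hD i),
    fun s hs => ?_⟩
  have h1 : ‖h s‖ = ‖a‖ := norm_eq_of_norm_sub_lt
    ((H s hs).trans_lt (mul_lt_of_lt_one_left ha0 hθ))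
  have h2 : h s ≠ 0 := norm_pos_iff.1 (h1 ▸ ha0)
  have h3 := geom_sum_mul ((a - h s) * a⁻¹) n
  have h4 : (h s)⁻¹ - a⁻¹ * ∑ i ∈ Finset.range n, ((a - h s) * a⁻¹) ^ i =
      (h s)⁻¹ * ((a - h s) * a⁻¹) ^ n := by
    have h5 : (a - h s) * a⁻¹ - 1 = -(h s * a⁻¹) := by field_simp; ring
    rw [h5] at h3
    have h6 : ((a - h s) * a⁻¹) ^ n =
        1 - h s * a⁻¹ * ∑ i ∈ Finset.range n, ((a - h s) * a⁻¹) ^ i := by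
      linear_combination -h3
    rw [h6, mul_sub, mul_one, ← mul_assoc, ← mul_assoc, inv_mul_cancel₀ h2, one_mul]
  rw [h4, norm_mul, norm_inv, h1, norm_pow, norm_mul, norm_inv]
  have h7 : ‖a - h s‖ * ‖a‖⁻¹ ≤ θ := by
    rw [← div_eq_mul_inv, div_le_iff₀ ha0]
    exact H s hs
  calc ‖a‖⁻¹ * (‖a - h s‖ * ‖a‖⁻¹) ^ n ≤ ‖a‖⁻¹ * θ ^ n := by gcongr
    _ < ‖a‖⁻¹ * (‖a‖ * δ) := by gcongr
    _ = δ := by field_simp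

theorem norm_eval_eq_of_forall_ne_zero [IsUltrametricDist K] [IsAlgClosed K] {a u w : K} {d : ℝ}
    (P : Polynomial K) (hP : ∀ α ∈ Metric.closedBall a d, P.eval α ≠ 0)
    (hu : u ∈ Metric.closedBall a d) (hw : w ∈ Metric.closedBall a d) :
    ‖P.eval u‖ = ‖P.eval w‖ := by
  have h := fun s => (IsAlgClosed.splits P).eval_eq_prod_roots s
  rw [h u, h w, norm_mul, norm_mul]
  congr 1
  have key : ∀ s : Multiset K, (∀ α ∈ s, α ∉ Metric.closedBall a d) →
      ‖(s.map (fun α => u - α)).prod‖ = ‖(s.map (fun α => w - α)).prod‖ := by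
    intro s
    induction s using Multiset.induction_on with
    | empty => simp
    | cons α s ih =>
      intro hs
      rw [Multiset.map_cons, Multiset.map_cons, Multiset.prod_cons, Multiset.prod_cons, norm_mul,
        norm_mul, ih fun β hβ => hs β (Multiset.mem_cons_of_mem hβ)]
      congr 1
      have hα := hs α (Multiset.mem_cons_self α s)
      simp only [Metric.mem_closedBall, dist_eq_norm] at hα hu hw
      have h1 : ‖u - w‖ ≤ d := norm_sub_trans hu (by rwa [norm_sub_rev])
      symm
      refine norm_eq_of_norm_sub_lt ?_
      rw [sub_sub_sub_cancel_right]
      by_contra! h2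
      exact hα (norm_sub_trans (y := u) (by rw [norm_sub_rev]; exact h2.trans h1) hu)
  refine key _ fun α hα hmem => hP α hmem ?_
  exact Polynomial.isRoot_of_mem_roots hα

/-- A uniform limit of polynomials on a disk whose absolute value is not constant takes
arbitrarily small values. -/
theorem IsPolyLimit.exists_norm_lt [IsUltrametricDist K] [IsAlgClosed K] {a u w : K} {d : ℝ}
    (hh : IsPolyLimit (Metric.closedBall a d) h)
    (hu : u ∈ Metric.closedBall a d) (hw : w ∈ Metric.closedBall a d) (huw : ‖h u‖ < ‖h w‖)
    {δ : ℝ} (hδ : 0 < δ) : ∃ α ∈ Metric.closedBall a d, ‖h α‖ < δ := by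
  obtain ⟨P, hP⟩ := hh (min δ ((‖h w‖ - ‖h u‖) / 2)) (lt_min hδ (by linarith))
  by_contra! H
  have h0 : ∀ α ∈ Metric.closedBall a d, P.eval α ≠ 0 := fun α hα h0 => by
    have h1 := (hP α hα).trans_le (min_le_left _ _)
    rw [h0, sub_zero] at h1
    exact h1.not_ge (H α hα)
  have h1 := norm_eval_eq_of_forall_ne_zero P h0 hu hw
  have h2 := (hP u hu).trans_le (min_le_right _ _)
  have h3 := (hP w hw).trans_le (min_le_right _ _)
  have h4 := norm_sub_norm_le (h w) (P.eval w)
  have h5 := norm_sub_norm_le (P.eval u) (h u)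
  rw [norm_sub_rev] at h5
  linarith

theorem exists_norm_mem_Ioo [IsAlgClosed K] {q : K} (hq0 : q ≠ 0) (hq1 : ‖q‖ < 1) {a b : ℝ}
    (ha : 0 < a) (hab : a < b) : ∃ z : K, a < ‖z‖ ∧ ‖z‖ < b := by
  have hb := ha.trans hab
  obtain ⟨n, hn⟩ := exists_pow_lt_of_lt_one (norm_pos_iff.2 hq0) ((div_lt_one hb).2 hab)
  have hn0 : n ≠ 0 := by
    rintro rfl
    rw [pow_zero] at hn
    exact hn.not_gt hq1
  obtain ⟨y, hy⟩ := IsAlgClosed.exists_pow_nat_eq q (Nat.pos_of_ne_zero hn0)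
  have hyn : ‖y‖ ^ n = ‖q‖ := by rw [← norm_pow, hy]
  have hy0 : 0 < ‖y‖ := norm_pos_iff.2 fun h => hq0 (by rw [← hy, h, zero_pow hn0])
  have hy1 : ‖y‖ < 1 := by
    by_contra! h
    exact (hyn ▸ one_le_pow₀ h : 1 ≤ ‖q‖).not_gt hq1
  have hab' : a / b < ‖y‖ := lt_of_pow_lt_pow_left₀ n hy0.le (by rwa [hyn])
  obtain ⟨i, hi1, hi2⟩ := exists_mem_Ico_zpow ha (one_lt_inv₀ hy0 |>.2 hy1)
  refine ⟨y⁻¹ ^ (i + 1), by rwa [norm_zpow, norm_inv], ?_⟩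
  rw [norm_zpow, norm_inv, zpow_add_one₀ (inv_ne_zero hy0.ne')]
  calc _ ≤ a * ‖y‖⁻¹ := by gcongr
    _ < b := by
      rw [div_lt_iff₀ hb] at hab'
      rw [← div_eq_mul_inv, div_lt_iff₀ hy0]
      linarith

variable [IsUltrametricDist K] [CompleteSpace K] {p : ℕ} [hp : Fact p.Prime] {R : ℕ → ℝ}
  {v : ℕ → K}

theorem gf_of_eq_zero {J : ℕ} (hJ : ∀ j, J < j → v j = 0) (z : K) :
    gf p v z = z ^ p / (p : K) * ∏ j ∈ Finset.range J, (1 - v (j + 1) * z) := by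
  rw [gf, tprod_eq_prod fun j hj => ?_]
  rw [hJ (j + 1) (by simpa using hj), zero_mul, sub_zero]

theorem IsPolyLimit.gf_comp (hR : IsRadii p R) (hpK : ‖(p : K)‖ = (p : ℝ)⁻¹)
    (hv : InvBound R v) (hD : Bornology.IsBounded D) (hh : IsPolyLimit D h) :
    IsPolyLimit D fun s => gf p v (h s) := by
  obtain ⟨B, hB0, hB⟩ := hh.exists_norm_le hD
  refine .of_forall_exists fun δ hδ => ?_
  have hφ := phi_pos hR hB0
  obtain ⟨J, hJ⟩ := hR.exists_lt (B * phi p R B / δ)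
  have hRJ := hR.pos (by omega : 1 ≤ J + 1)
  set v' : ℕ → K := fun j => if j ≤ J then v j else 0
  have hv' : InvBound R v' := fun j hj => by
    simp only [v']
    split_ifs
    · exact hv j hj
    · simpa using (hR.pos hj).le
  have hσ : ∀ j, 1 ≤ j → ‖v j - v' j‖ ≤ (R (J + 1))⁻¹ := fun j hj => by
    simp only [v']
    split_ifs with hjJ
    · simpa using hRJ.le
    · rw [sub_zero]
      exact (hv j hj).trans (inv_anti₀ hRJ (hR.le (by omega) (by omega)))
  refine ⟨fun s => gf p v' (h s), ?_, fun s hs => ?_⟩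
  · simp_rw [gf_of_eq_zero (v := v') (J := J) (p := p) fun j hj => if_neg (by omega),
      div_eq_mul_inv]
    exact ((hh.pow hD p).mul hD (.const _)).mul hD
      (.finset_prod hD _ fun i _ => (IsPolyLimit.const 1).sub hD ((IsPolyLimit.const _).mul hD hh))
  · have h1 := norm_gf_sub_le (κ := B * (R (J + 1))⁻¹) hR hpK hv hv' hσ (hB s hs) (hB s hs)
      (by positivity) (by rw [sub_self, norm_zero]; positivity) le_rfl
    refine h1.trans_lt ?_
    rw [div_lt_iff₀ hδ] at hJ
    calc B * (R (J + 1))⁻¹ * phi p R B = B * phi p R B * (R (J + 1))⁻¹ := by ring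
      _ < R (J + 1) * δ * (R (J + 1))⁻¹ := by gcongr
      _ = δ := by field_simp

theorem IsPolyLimit.iterate_update (hR : IsRadii p R) (hpK : ‖(p : K)‖ = (p : ℝ)⁻¹)
    (hv : InvBound R v) (hD : Bornology.IsBounded D) (hh : IsPolyLimit D h) {q : ℕ} (hq : 1 ≤ q)
    (x : K) (i : ℕ) : IsPolyLimit D fun s => (gf p (Function.update v q (h s)))^[i] x := by
  induction i with
  | zero => exact .const x
  | succ i ih =>
    simp_rw [Function.iterate_succ_apply']
    simp only [gf_update hR hv hq (h _) ((gf p (Function.update v q (h _)))^[i] x)]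
    exact (ih.gf_comp hR hpK (hv.update_zero hR q) hD).mul hD
      ((IsPolyLimit.const 1).sub hD (hh.mul hD ih))

end PolyLimit

/-! ### Comparison of orbits along one block -/

section Block

variable {K : Type*} [NormedField K] [IsUltrametricDist K] [CompleteSpace K]
  {p : ℕ} [hp : Fact p.Prime] {R r : ℕ → ℝ} {m l : ℕ → ℕ} {v v' : ℕ → K} {z w : K}

/-- Off the critical radii, the orbit of absolute values is governed by `phi`. -/
theorem norm_iterate_gf_eq (hR : IsRadii p R) (hpK : ‖(p : K)‖ = (p : ℝ)⁻¹) (hv : InvRadii R v)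
    {n : ℕ} (h : ∀ i < n, ∀ j, 1 ≤ j → (phi p R)^[i] ‖z‖ ≠ R j) :
    ‖(gf p v)^[n] z‖ = (phi p R)^[n] ‖z‖ := by
  induction n with
  | zero => rfl
  | succ n ih =>
    have ih' := ih fun i hi => h i (by omega)
    rw [Function.iterate_succ_apply', Function.iterate_succ_apply', ← ih']
    exact norm_gf_eq_of_ne hR hpK hv fun j hj => ih' ▸ h n (by omega) j hj

theorem norm_iterate_gf_le (hR : IsRadii p R) (hpK : ‖(p : K)‖ = (p : ℝ)⁻¹) (hv : InvBound R v)
    {t : ℝ} (hz : ‖z‖ ≤ t) (n : ℕ) : ‖(gf p v)^[n] z‖ ≤ (phi p R)^[n] t := by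
  induction n with
  | zero => exact hz
  | succ n ih =>
    rw [Function.iterate_succ_apply', Function.iterate_succ_apply']
    exact norm_gf_le hR hpK hv ih

theorem Admissible.iterate_le_Sse (hA : Admissible p R m l r) {k : ℕ} (hk : 1 ≤ k) {i : ℕ}
    (hi : i < m k + nseq p R k) : (phi p R)^[i] (r k) ≤ Sse p R k := by
  rw [← hA.iter_eq_Sse k hk]
  exact (phi_iterate_strictMono hA.radii (hA.entry k hk).rho_lt).monotone (by omega)

theorem Admissible.Sse_mul_lt_one (hA : Admissible p R m l r) {k : ℕ} (hk : 1 ≤ k) :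
    Sse p R k * paramRadius p R l k < 1 := by
  have h1 := hA.Sse_mul_paramRadius hk
  have h2 := prime_lt_lam hA.radii hk
  have h3 : lam p R k ≤ lam p R k ^ l (k + 1) :=
    le_self_pow₀ (one_lt_lam hA.radii hk).le (by have := hA.one_le_l (k + 1) (by omega); omega)
  have h4 : 0 < lam p R k ^ l (k + 1) := pow_pos (lam_pos hA.radii hk) _
  refine lt_of_mul_lt_mul_right (a := lam p R k ^ l (k + 1)) ?_ h4.le
  calc _ = (p : ℝ) := by rw [← h1]; ring
    _ < _ := by linarith

/-- The relative error bound along the passage from the start of block `k` to `B_k`. -/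
def passageError (p : ℕ) (R : ℕ → ℝ) (m : ℕ) (r d σ : ℝ) (i : ℕ) : ℝ :=
  max (d / rho p / p ^ min i m) (if i = 0 then 0 else (phi p R)^[i - 1] r * σ)

theorem passageError_nonneg {m : ℕ} {r₀ d σ : ℝ} {i : ℕ} (hd : 0 ≤ d) :
    0 ≤ passageError p R m r₀ d σ i :=
  le_max_of_le_left (by have := rho_pos (p := p); positivity)

theorem norm_passage_sub_le (hA : Admissible p R m l r) (hpK : ‖(p : K)‖ = (p : ℝ)⁻¹)
    (hv : InvRadii R v) (hv' : InvRadii R v') {k : ℕ} (hk : 1 ≤ k) {σ d : ℝ}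
    (hσ0 : 0 ≤ σ) (hσk : σ ≤ paramRadius p R l k)
    (hσ : ∀ j, 1 ≤ j → ‖v j - v' j‖ ≤ σ) (hz : ‖z‖ = r k) (hd : d ≤ rho p ^ 2)
    (hzw : ‖z - w‖ ≤ d) {i : ℕ} (hi : i ≤ m k + nseq p R k) :
    ‖(gf p v)^[i] z‖ = (phi p R)^[i] (r k) ∧ ‖(gf p v')^[i] w‖ = (phi p R)^[i] (r k) ∧
      ‖(gf p v)^[i] z - (gf p v')^[i] w‖ ≤
        passageError p R (m k) (r k) d σ i * (phi p R)^[i] (r k) := by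
  have hR := hA.radii
  have he := hA.entry k hk
  have hρ := rho_pos (p := p)
  have hρ1 := rho_lt_one (p := p)
  have hd0 : 0 ≤ d := (norm_nonneg _).trans hzw
  have hdρ : d / rho p ≤ rho p := by rw [div_le_iff₀ hρ, ← sq]; exact hd
  have hp1 : (1 : ℝ) ≤ p := by exact_mod_cast hp.out.one_le
  have hp0 := prime_pos_real (p := p)
  have hpos := phi_iterate_pos hR he.pos
  have hmono := phi_iterate_strictMono hR he.rho_lt
  have hzn : ∀ n ≤ m k + nseq p R k, ‖(gf p v)^[n] z‖ = (phi p R)^[n] (r k) := fun n hn => by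
    rw [← hz]
    exact norm_iterate_gf_eq hR hpK hv fun i hi j hj => hz ▸ he.iter_ne i (by omega) j hj
  have hσρ : σ < rho p := hσk.trans_lt (hA.paramRadius_lt_rho hk)
  have hterm : ∀ n, d / rho p / p ^ n ≤ rho p := fun n =>
    (div_le_self (by positivity) (one_le_pow₀ hp1)).trans hdρ
  have hlt1 : ∀ n ≤ m k + nseq p R k, passageError p R (m k) (r k) d σ n < 1 := fun n hn => by
    refine max_lt ((hterm _).trans_lt hρ1) ?_
    split_ifs with h0
    · exact one_pos
    · calc _ ≤ Sse p R k * paramRadius p R l k :=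
          mul_le_mul (hA.iterate_le_Sse hk (by omega)) hσk hσ0 (hA.Sse_pos hk).le
        _ < 1 := hA.Sse_mul_lt_one hk
  suffices H : ‖(gf p v)^[i] z - (gf p v')^[i] w‖ ≤
      passageError p R (m k) (r k) d σ i * (phi p R)^[i] (r k) by
    refine ⟨hzn i hi, ?_, H⟩
    rw [← hzn i hi]
    refine norm_eq_of_norm_sub_lt (H.trans_lt ?_)
    rw [hzn i hi]
    exact mul_lt_of_lt_one_left (hpos i) (hlt1 i hi)
  induction i with
  | zero =>
    simp only [Function.iterate_zero, id_eq, passageError, Nat.zero_min, pow_zero, div_one, if_true]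
    rw [max_eq_left (by positivity)]
    refine hzw.trans ?_
    rw [div_mul_eq_mul_div, le_div_iff₀ hρ]
    exact mul_le_mul_of_nonneg_left he.rho_lt.le hd0
  | succ i ih =>
    have ih := ih (by omega)
    have hwi : ‖(gf p v')^[i] w‖ = (phi p R)^[i] (r k) := by
      rw [← hzn i (by omega)]
      refine norm_eq_of_norm_sub_lt (ih.trans_lt ?_)
      rw [hzn i (by omega)]
      exact mul_lt_of_lt_one_left (hpos i) (hlt1 i (by omega))
    have hlast : (phi p R)^[i] (r k) * σ ≤ passageError p R (m k) (r k) d σ (i + 1) := by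
      refine le_max_of_le_right ?_
      rw [if_neg (by omega), Nat.add_sub_cancel]
    have hprev : (if i = 0 then 0 else (phi p R)^[i - 1] (r k) * σ) ≤ (phi p R)^[i] (r k) * σ := by
      split_ifs
      · exact mul_nonneg (hpos i).le hσ0
      · exact mul_le_mul_of_nonneg_right (hmono.monotone (by omega)) hσ0
    rw [Function.iterate_succ_apply', Function.iterate_succ_apply',
      Function.iterate_succ_apply' (phi p R)]
    by_cases him : i < m k
    · refine norm_gf_sub_le_of_lt_one hR hpK hv.invBound hv'.invBound hσ (hzn i (by omega)).le
        hwi.le (he.iter_lt_one i him).le ?_ (passageError_nonneg hd0) ih ?_ hlast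
      · refine max_le (hterm _) (hprev.trans ?_)
        exact (mul_le_of_le_one_left hσ0 (he.iter_lt_one i him).le).trans hσρ.le
      · rw [passageError, ← max_div_div_right hp0.le]
        refine max_le (le_max_of_le_left (le_of_eq ?_)) ?_
        · rw [min_eq_left him.le, min_eq_left (by omega : i + 1 ≤ m k), pow_succ, div_div _ _ (p : ℝ)]
        · refine (div_le_self ?_ hp1).trans (hprev.trans hlast)
          split_ifs
          · exact le_rfl
          · exact mul_nonneg (hpos _).le hσ0
    · refine norm_gf_sub_le hR hpK hv.invBound hv'.invBound hσ (hzn i (by omega)).le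
        hwi.le (passageError_nonneg hd0) (ih.trans ?_) hlast
      refine mul_le_mul_of_nonneg_right (max_le (le_max_of_le_left (le_of_eq ?_))
        (hprev.trans hlast)) (hpos i).le
      rw [min_eq_right (by omega), min_eq_right (by omega)]

/-- Comparison of two orbits while the first one stays in `B_k`. -/
theorem norm_iterate_sub_le_of_mem_disk (hR : IsRadii p R) (hpK : ‖(p : K)‖ = (p : ℝ)⁻¹)
    (hv : InvRadii R v) (hv' : InvRadii R v') {k n : ℕ} (hk : 1 ≤ k) {σ δ : ℝ}
    (hσ : ∀ j, 1 ≤ j → ‖v j - v' j‖ ≤ σ) (hkk : v k = v' k)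
    (hz : ∀ i < n, ‖1 - v k * (gf p v)^[i] z‖ < 1) (hzw : ‖z - w‖ ≤ δ)
    (hδ : ∀ i < n, lam p R k ^ i * δ < R k) (hσδ : R k * σ * R k ≤ lam p R k * δ)
    (hend : R k * σ * ‖(gf p v)^[n] z‖ ≤ lam p R k ^ n * δ) {i : ℕ} (hi : i ≤ n) :
    ‖(gf p v)^[i] z - (gf p v')^[i] w‖ ≤ lam p R k ^ i * δ := by
  have hl := one_lt_lam hR hk
  have hδ0 : 0 ≤ δ := (norm_nonneg _).trans hzw
  induction i with
  | zero => simpa using hzw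
  | succ i ih =>
    have ih := ih (by omega)
    have h1 := hz i (by omega)
    have h2 := norm_eq_of_norm_one_sub_lt hR hv hk h1
    have h3 : ‖(gf p v')^[i] w‖ = R k := by
      rw [← h2]
      refine norm_eq_of_norm_sub_lt (ih.trans_lt ?_)
      rw [h2]
      exact hδ i (by omega)
    have h4 := norm_gf_sub_eq hR hpK hv' hk (hkk ▸ h1) h2 h3
    have h5 := norm_gf_sub_le_param hR hpK hv hv' hσ hk hkk h2
    rw [← Function.iterate_succ_apply' (gf p v)] at h5
    rw [Function.iterate_succ_apply', Function.iterate_succ_apply']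
    refine norm_sub_trans (y := gf p v' ((gf p v)^[i] z)) ?_ ?_
    · rw [← Function.iterate_succ_apply' (gf p v)]
      refine h5.trans ?_
      rcases hi.eq_or_lt with rfl | hi
      · exact hend
      · rw [norm_eq_of_norm_one_sub_lt hR hv hk (hz _ hi)]
        refine hσδ.trans ?_
        exact mul_le_mul_of_nonneg_right (le_self_pow₀ hl.le (by omega)) hδ0
    · rw [h4, pow_succ', mul_assoc]
      exact mul_le_mul_of_nonneg_left ih (by linarith)

/-- The orbit of `z` follows the `k`-th block of the itinerary. -/
def FollowsBlock (p : ℕ) (R : ℕ → ℝ) (m l : ℕ → ℕ) (r : ℕ → ℝ) (v : ℕ → K) (k : ℕ) (z : K) :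
    Prop :=
  ‖z‖ = r k ∧ ∀ i < l (k + 1), ‖1 - v k * (gf p v)^[i] ((gf p v)^[m k + nseq p R k] z)‖ < 1

theorem Admissible.lam_pow_mul_passageError (hA : Admissible p R m l r) {k : ℕ} (hk : 1 ≤ k)
    {σ d : ℝ} (hd : 0 ≤ d) :
    lam p R k ^ l (k + 1) *
      (passageError p R (m k) (r k) d σ (m k + nseq p R k) * R k) ≤
        max d (expFactor p R l (k + 1) * σ) := by
  have hn := hA.one_le_n k hk
  have hRk := hA.radii.pos hk
  have hl := lam_pos hA.radii hk
  have hρ := rho_pos (p := p)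
  have hp0 := prime_pos_real (p := p)
  rw [passageError, if_neg (by omega), hA.iter_eq_Sse k hk, min_eq_right (by omega),
    max_mul_of_nonneg _ _ hRk.le, mul_max_of_nonneg _ _ (by positivity)]
  refine max_le_max ?_ (le_of_eq ?_)
  · have h := hA.mul_lam_pow_lt k hk
    rw [show lam p R k ^ l (k + 1) * (d / rho p / p ^ m k * R k) =
      d * (R k * lam p R k ^ l (k + 1)) / (rho p * p ^ m k) by field_simp,
      div_le_iff₀ (by positivity)]
    exact mul_le_mul_of_nonneg_left h.le hd
  · rw [Admissible.expFactor_succ hk]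
    ring

theorem FollowsBlock.compare (hA : Admissible p R m l r) (hpK : ‖(p : K)‖ = (p : ℝ)⁻¹)
    (hv : InvRadii R v) (hv' : InvRadii R v') {k : ℕ} (hk : 1 ≤ k) {σ d : ℝ}
    (hσ0 : 0 ≤ σ) (hσk : σ ≤ paramRadius p R l k)
    (hσ : ∀ j, 1 ≤ j → ‖v j - v' j‖ ≤ σ) (hkk : v k = v' k)
    (hz : FollowsBlock p R m l r v k z) (hd : d ≤ rho p ^ 2) (hzw : ‖z - w‖ ≤ d)
    (hend : ‖(gf p v)^[l (k + 1)] ((gf p v)^[m k + nseq p R k] z)‖ ≤ p * R k) :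
    FollowsBlock p R m l r v' k w ∧
      ‖(gf p v)^[l (k + 1)] ((gf p v)^[m k + nseq p R k] z) -
        (gf p v')^[l (k + 1)] ((gf p v')^[m k + nseq p R k] w)‖ ≤
          max d (expFactor p R l (k + 1) * σ) := by
  have hR := hA.radii
  have hd0 : 0 ≤ d := (norm_nonneg _).trans hzw
  have hn := hA.one_le_n k hk
  have hRk := hA.radii.pos hk
  have hRk1 := one_lt_radius hR hk
  have hl := lam_pos hR hk
  have hl1 := one_lt_lam hR hk
  have hS := hA.Sse_pos hk
  have hp0 := prime_pos_real (p := p)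
  have hl0 : 1 ≤ l (k + 1) := hA.one_le_l _ (by omega)
  have hpass := fun i hi => norm_passage_sub_le (i := i) hA hpK hv hv' hk hσ0 hσk hσ hz.1 hd hzw hi
  obtain ⟨-, -, h1⟩ := hpass _ le_rfl
  have h2 := hA.lam_pow_mul_passageError hk hd0 (σ := σ)
  rw [(hA.entry k hk).iter_eq] at h1
  set δ := passageError p R (m k) (r k) d σ (m k + nseq p R k) * R k with hδ
  have hδ0 : 0 ≤ δ := (norm_nonneg _).trans h1
  have hSδ : R k * Sse p R k * σ ≤ δ := by
    rw [hδ, passageError, if_neg (by omega), hA.iter_eq_Sse k hk]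
    calc _ = Sse p R k * σ * R k := by ring
      _ ≤ _ := mul_le_mul_of_nonneg_right (le_max_right _ _) hRk.le
  have hmax : max d (expFactor p R l (k + 1) * σ) ≤ p * R k := by
    refine max_le ?_ ?_
    · have := pow_le_one₀ (n := 2) (rho_pos (p := p)).le rho_lt_one.le
      have := two_le_prime_real (p := p)
      nlinarith
    · rw [← hA.expFactor_succ_mul hk]
      exact mul_le_mul_of_nonneg_left hσk (hA.expFactor_succ_pos hk).le
  have hsmall : ∀ i < l (k + 1), lam p R k ^ i * δ < R k := fun i hi => by
    have h3 : lam p R k * (lam p R k ^ i * δ) ≤ p * R k := by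
      refine le_trans ?_ (h2.trans hmax)
      rw [← mul_assoc, ← pow_succ']
      exact mul_le_mul_of_nonneg_right (pow_le_pow_right₀ hl1.le hi) hδ0
    have h4 := prime_lt_lam hR hk
    have h5 : lam p R k * (lam p R k ^ i * δ) < lam p R k * R k :=
      h3.trans_lt (mul_lt_mul_of_pos_right h4 hRk)
    exact lt_of_mul_lt_mul_left h5 hl.le
  have hcomp := fun i hi => norm_iterate_sub_le_of_mem_disk (i := i) hR hpK hv hv' hk hσ hkk hz.2 h1
    hsmall (by
      calc R k * σ * R k ≤ R k * σ * (lam p R k * Sse p R k) :=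
            mul_le_mul_of_nonneg_left (hA.radius_lt_lam_mul_Sse hk).le (by positivity)
        _ = lam p R k * (R k * Sse p R k * σ) := by ring
        _ ≤ _ := mul_le_mul_of_nonneg_left hSδ hl.le) (by
      calc R k * σ * _ ≤ R k * σ * (p * R k) := mul_le_mul_of_nonneg_left hend (by positivity)
        _ ≤ R k * σ * (Sse p R k * lam p R k ^ l (k + 1)) :=
          mul_le_mul_of_nonneg_left (hA.prime_mul_radius_lt hk).le (by positivity)
        _ = lam p R k ^ l (k + 1) * (R k * Sse p R k * σ) := by ring
        _ ≤ _ := mul_le_mul_of_nonneg_left hSδ (by positivity)) hi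
  refine ⟨⟨(hpass 0 (by omega)).2.1, fun i hi => ?_⟩, (hcomp _ le_rfl).trans h2⟩
  exact norm_one_sub_lt_of_norm_sub_lt hR hv' hk (hkk ▸ hz.2 i hi)
    ((hcomp i hi.le).trans_lt (hsmall i hi))

/-! ### Comparison of orbits along the first blocks -/

theorem iterate_Lseq_succ (f : K → K) {n : ℕ → ℕ} {k : ℕ} (hk : 1 ≤ k) (x : K) :
    f^[Lseq m n l (k + 1)] x = f^[l (k + 1)] (f^[m k + n k] (f^[Lseq m n l k] x)) := by
  obtain ⟨k, rfl⟩ := Nat.exists_eq_add_of_le' hk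
  rw [← Function.iterate_add_apply, ← Function.iterate_add_apply, show Lseq m n l (k + 1 + 1) =
    l (k + 1 + 1) + (m (k + 1) + n (k + 1)) + Lseq m n l (k + 1) by rw [Lseq]; ring]

/-- The orbit of `x` follows the first `k` blocks of the itinerary. -/
def FollowsBlocks (p : ℕ) (R : ℕ → ℝ) (m l : ℕ → ℕ) (r : ℕ → ℝ) (v : ℕ → K) (x : K) (k : ℕ) :
    Prop :=
  ∀ j, 1 ≤ j → j ≤ k → FollowsBlock p R m l r v j ((gf p v)^[Lseq m (nseq p R) l j] x)

theorem FollowsBlocks.norm_lt_one (hA : Admissible p R m l r) {x : K} {k j : ℕ} (hj : 1 ≤ j)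
    (hjk : j ≤ k) (h : FollowsBlocks p R m l r v x k) :
    ‖(gf p v)^[Lseq m (nseq p R) l j] x‖ < 1 := by
  rw [(h j hj hjk).1]
  exact (hA.entry j hj).iter_lt_one 0 (hA.one_le_m j hj)

theorem Admissible.expFactor_le_succ (hA : Admissible p R m l r) {k : ℕ} (hk : 1 ≤ k) :
    expFactor p R l k ≤ expFactor p R l (k + 1) := by
  have h1 := hA.expFactor_mul_le k k hk le_rfl
  have h2 := hA.expFactor_succ_mul hk
  refine le_of_mul_le_mul_right (h1.trans ?_) (hA.paramRadius_pos hk)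
  rw [h2]
  have h3 := two_le_prime_real (p := p)
  have h4 := one_lt_radius hA.radii hk
  have h5 := pow_le_one₀ (n := 2) (rho_pos (p := p)).le rho_lt_one.le
  nlinarith

theorem FollowsBlocks.compare (hA : Admissible p R m l r) (hpK : ‖(p : K)‖ = (p : ℝ)⁻¹)
    (hv : InvRadii R v) (hv' : InvRadii R v') {k : ℕ} (hk : 1 ≤ k) {σ d : ℝ}
    (hσ0 : 0 ≤ σ) (hσk : σ ≤ paramRadius p R l k)
    (hσ : ∀ j, 1 ≤ j → ‖v j - v' j‖ ≤ σ) (hkk : ∀ j, 1 ≤ j → j ≤ k → v j = v' j) {x y : K}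
    (hx : FollowsBlocks p R m l r v x k)
    (hend : ‖(gf p v)^[Lseq m (nseq p R) l (k + 1)] x‖ ≤ p * R k)
    (hd : d ≤ rho p ^ 2) (hxy : ‖x - y‖ ≤ d) :
    FollowsBlocks p R m l r v' y k ∧ ∀ j, 1 ≤ j → j ≤ k + 1 →
      ‖(gf p v)^[Lseq m (nseq p R) l j] x - (gf p v')^[Lseq m (nseq p R) l j] y‖ ≤
        max d (expFactor p R l j * σ) := by
  have hdm : ∀ j, 1 ≤ j → j ≤ k → max d (expFactor p R l j * σ) ≤ rho p ^ 2 := fun j hj hjk =>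
    max_le hd ((mul_le_mul_of_nonneg_left hσk (hA.expFactor_nonneg hj)).trans
      (hA.expFactor_mul_le j k hj hjk))
  have hends : ∀ j, 1 ≤ j → j ≤ k → ‖(gf p v)^[Lseq m (nseq p R) l (j + 1)] x‖ ≤ p * R j :=
    fun j hj hjk => by
    rcases hjk.eq_or_lt with rfl | hlt
    · exact hend
    · have h1 := hx.norm_lt_one hA (by omega : 1 ≤ j + 1) hlt
      have h2 := two_le_prime_real (p := p)
      have h3 := one_lt_radius hA.radii hj
      nlinarith
  have herr : ∀ j, 1 ≤ j → j ≤ k + 1 →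
      ‖(gf p v)^[Lseq m (nseq p R) l j] x - (gf p v')^[Lseq m (nseq p R) l j] y‖ ≤
        max d (expFactor p R l j * σ) := by
    intro j hj
    induction j, hj using Nat.le_induction with
    | base => exact fun _ => le_max_of_le_left hxy
    | succ j hj ih =>
      intro hjk
      have h1 := hends j hj (by omega)
      rw [iterate_Lseq_succ _ hj] at h1
      rw [iterate_Lseq_succ _ hj, iterate_Lseq_succ _ hj]
      refine ((FollowsBlock.compare hA hpK hv hv' hj hσ0
        (hσk.trans (hA.paramRadius_anti hj (by omega))) hσ (hkk j hj (by omega))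
        (hx j hj (by omega)) (hdm j hj (by omega)) (ih (by omega)) h1).2).trans ?_
      refine max_le (max_le (le_max_left _ _) ?_) (le_max_right _ _)
      refine le_max_of_le_right (mul_le_mul_of_nonneg_right ?_ hσ0)
      exact hA.expFactor_le_succ hj
  refine ⟨fun j hj hjk => ?_, herr⟩
  have h1 := hends j hj hjk
  rw [iterate_Lseq_succ _ hj] at h1
  exact (FollowsBlock.compare hA hpK hv hv' hj hσ0
    (hσk.trans (hA.paramRadius_anti hj hjk)) hσ (hkk j hj hjk)
    (hx j hj hjk) (hdm j hj hjk) (herr j hj (by omega)) h1).1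

end Block

section Perturb

variable {K : Type*} [NormedField K] [IsUltrametricDist K] [CompleteSpace K]
  {p : ℕ} [hp : Fact p.Prime] {R r : ℕ → ℝ} {m l : ℕ → ℕ} {v v' : ℕ → K} {z w : K}

/-! ### Exact dependence on one parameter -/

theorem norm_update_sub_le (v : ℕ → K) (q : ℕ) (t : K) (j : ℕ) :
    ‖v j - Function.update v q t j‖ ≤ ‖v q - t‖ := by
  rcases eq_or_ne j q with rfl | hj
  · rw [Function.update_self]
  · rw [Function.update_of_ne hj, sub_self, norm_zero]
    exact norm_nonneg _

theorem norm_gf_sub_update_eq (hR : IsRadii p R) (hv : InvRadii R v) {q : ℕ} (hq : 1 ≤ q)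
    (hz : ‖z‖ < R q) (t : K) :
    ‖gf p v z - gf p (Function.update v q t) z‖ = ‖gf p v z‖ * (‖z‖ * ‖v q - t‖) := by
  have h1 : ‖gf p v z‖ = ‖gf p (Function.update v q 0) z‖ := by
    rw [gf_eq_mul hR hv.invBound hq, norm_mul, norm_one_sub_eq_of_lt hR hv.invBound hq hz, mul_one]
  rw [h1, gf_eq_mul hR hv.invBound hq z, gf_update hR hv.invBound hq t, ← mul_sub, norm_mul,
    show 1 - v q * z - (1 - t * z) = -(z * (v q - t)) by ring, norm_neg, norm_mul]

theorem norm_passage_sub_update_eq (hA : Admissible p R m l r) (hpK : ‖(p : K)‖ = (p : ℝ)⁻¹)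
    (hv : InvRadii R v) {k : ℕ} (hk : 1 ≤ k) {t : K}
    (hv' : InvRadii R (Function.update v (k + 1) t))
    (htk : ‖v (k + 1) - t‖ ≤ paramRadius p R l k) (ht : v (k + 1) ≠ t) (hz : ‖z‖ = r k)
    (hzw : ‖z - w‖ ≤ expFactor p R l k * ‖v (k + 1) - t‖) :
    ‖(gf p v)^[m k + nseq p R k] z -
      (gf p (Function.update v (k + 1) t))^[m k + nseq p R k] w‖ =
        R k * Sse p R k * ‖v (k + 1) - t‖ := by
  have hR := hA.radii
  have hm := hA.one_le_m k hk
  have hn := hA.one_le_n k hk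
  have hS := hA.Sse_pos hk
  have hRk := hR.pos hk
  have hρ := rho_pos (p := p)
  have hp0 := prime_pos_real (p := p)
  set v' := Function.update v (k + 1) t
  set σ := ‖v (k + 1) - t‖
  have hσ0 : 0 < σ := norm_pos_iff.2 (sub_ne_zero.2 ht)
  have hE := hA.expFactor_nonneg hk
  have hd : expFactor p R l k * σ ≤ rho p ^ 2 :=
    (mul_le_mul_of_nonneg_left htk hE).trans (hA.expFactor_mul_le k k hk le_rfl)
  obtain ⟨M, hM⟩ : ∃ M, m k + nseq p R k = M + 1 := ⟨m k + nseq p R k - 1, by omega⟩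
  have hSM := hA.iter_eq_Sse k hk
  rw [hM, Nat.add_sub_cancel] at hSM
  obtain ⟨h1, h2, h3⟩ := norm_passage_sub_le (i := M) hA hpK hv hv' hk hσ0.le htk
    (fun j _ => norm_update_sub_le v (k + 1) t j) hz hd hzw (by omega)
  have hκ : passageError p R (m k) (r k) (expFactor p R l k * σ) σ M < Sse p R k * σ := by
    refine max_lt ?_ ?_
    · rw [min_eq_right (by omega), div_div, div_lt_iff₀ (by positivity)]
      have h4 := hA.expFactor_lt k hk
      have h5 := hA.one_le_Sse hk
      have h6 : rho p ^ 2 * p ^ m k ≤ Sse p R k * (rho p * p ^ m k) := by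
        have : rho p ≤ Sse p R k := rho_lt_one.le.trans h5
        calc rho p ^ 2 * (p : ℝ) ^ m k = rho p * (rho p * p ^ m k) := by ring
          _ ≤ _ := by gcongr
      calc expFactor p R l k * σ < Sse p R k * (rho p * p ^ m k) * σ := by
            gcongr
            exact h4.trans_le h6
        _ = _ := by ring
    · rw [if_neg (by omega), ← hSM]
      exact mul_lt_mul_of_pos_right (phi_iterate_strictMono hR (hA.entry k hk).rho_lt
        (by omega : M - 1 < M)) hσ0
  rw [hSM] at h1 h2 h3
  rw [hM, Function.iterate_succ_apply', Function.iterate_succ_apply']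
  set a := (gf p v)^[M] z
  set b := (gf p v')^[M] w
  have haR : ‖a‖ < R (k + 1) := by
    rw [h1]
    exact (hA.Sse_lt hk).trans (hR.lt hk (by omega))
  have h4 : ‖gf p v a‖ = R k := by
    rw [norm_gf_eq_of_ne hR hpK hv, h1, phi_Sse hR hk]
    intro j hj
    rw [h1, ← hSM]
    exact (hA.entry k hk).iter_ne M (by omega) j hj
  have h5 : ‖gf p v a - gf p v' a‖ = R k * Sse p R k * σ := by
    rw [norm_gf_sub_update_eq hR hv (by omega) haR, h4, h1, mul_assoc]
  have h6 : ‖gf p v' a - gf p v' b‖ < R k * Sse p R k * σ := by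
    refine (norm_gf_sub_le (κ := passageError p R (m k) (r k) (expFactor p R l k * σ) σ M) (σ := 0)
      hR hpK hv'.invBound hv'.invBound (fun j _ => by simp) h1.le h2.le
      (passageError_nonneg (by positivity)) h3
      (by rw [mul_zero]; exact passageError_nonneg (by positivity))).trans_lt ?_
    rw [phi_Sse hR hk]
    calc _ < Sse p R k * σ * R k := mul_lt_mul_of_pos_right hκ hRk
      _ = _ := by ring
  rw [← sub_add_sub_cancel _ (gf p v' a), norm_add_eq_of_lt (h5 ▸ h6), h5]

theorem norm_endpoint_sub_update_eq (hA : Admissible p R m l r) (hpK : ‖(p : K)‖ = (p : ℝ)⁻¹)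
    (hv : InvRadii R v) {k : ℕ} (hk : 1 ≤ k) {t : K}
    (hv' : InvRadii R (Function.update v (k + 1) t))
    (htk : ‖v (k + 1) - t‖ ≤ paramRadius p R l k) {x : K}
    (hx : FollowsBlocks p R m l r v x k)
    (hend : ‖(gf p v)^[Lseq m (nseq p R) l (k + 1)] x‖ ≤ p * R k) :
    ‖(gf p v)^[Lseq m (nseq p R) l (k + 1)] x -
      (gf p (Function.update v (k + 1) t))^[Lseq m (nseq p R) l (k + 1)] x‖ =
        expFactor p R l (k + 1) * ‖v (k + 1) - t‖ := by
  rcases eq_or_ne (v (k + 1)) t with rfl | ht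
  · simp
  have hR := hA.radii
  have hl := lam_pos hR hk
  have hl1 := one_lt_lam hR hk
  have hS := hA.Sse_pos hk
  have hRk := hR.pos hk
  have hkk : ∀ j, 1 ≤ j → j ≤ k → v j = Function.update v (k + 1) t j := fun j _ hj => by
    rw [Function.update_of_ne (by omega)]
  have hσ := fun j (_ : 1 ≤ j) => norm_update_sub_le v (k + 1) t j
  obtain ⟨h1, h2⟩ := FollowsBlocks.compare (y := x) (d := 0) hA hpK hv hv' hk (norm_nonneg _) htk hσ
    hkk hx hend (sq_nonneg _) (by simp)
  have h3 := h2 k hk (by omega)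
  rw [max_eq_right (mul_nonneg (hA.expFactor_nonneg hk) (norm_nonneg _))] at h3
  have h4 := norm_passage_sub_update_eq hA hpK hv hk hv' htk ht (hx k hk le_rfl).1 h3
  have h5 := (hx k hk le_rfl).2
  have h6 := (h1 k hk le_rfl).2
  rw [iterate_Lseq_succ _ hk] at hend
  rw [iterate_Lseq_succ _ hk, iterate_Lseq_succ _ hk]
  have hkk' := hkk k hk le_rfl
  set v' := Function.update v (k + 1) t
  set σ := ‖v (k + 1) - t‖
  have hσ0 : 0 < σ := norm_pos_iff.2 (sub_ne_zero.2 ht)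
  set a := (gf p v)^[m k + nseq p R k] ((gf p v)^[Lseq m (nseq p R) l k] x)
  set b := (gf p v')^[m k + nseq p R k] ((gf p v')^[Lseq m (nseq p R) l k] x)
  have key : ∀ i ≤ l (k + 1), ‖(gf p v)^[i] a - (gf p v')^[i] b‖ =
      lam p R k ^ i * (R k * Sse p R k * σ) := by
    intro i
    induction i with
    | zero => intro _; simpa using h4
    | succ i ih =>
      intro hi
      have ih := ih (by omega)
      have h7 := h5 i (by omega)
      have h8 := norm_eq_of_norm_one_sub_lt hR hv hk h7
      have h9 := norm_eq_of_norm_one_sub_lt hR hv' hk (h6 i (by omega))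
      have h10 := norm_gf_sub_eq hR hpK hv' hk (hkk' ▸ h7) h8 h9
      have h11 := norm_gf_sub_le_param hR hpK hv hv' hσ hk hkk' h8
      rw [Function.iterate_succ_apply', Function.iterate_succ_apply',
        ← sub_add_sub_cancel _ (gf p v' ((gf p v)^[i] a)), add_comm, norm_add_eq_of_lt, h10, ih]
      · ring
      · rw [h10, ih]
        refine h11.trans_lt ?_
        rw [← Function.iterate_succ_apply' (gf p v)]
        have h12 : ‖(gf p v)^[i.succ] a‖ < lam p R k ^ (i + 1) * Sse p R k := by
          rcases hi.eq_or_lt with hi | hi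
          · rw [Nat.succ_eq_add_one, hi, mul_comm]
            exact hend.trans_lt (hA.prime_mul_radius_lt hk)
          · rw [norm_eq_of_norm_one_sub_lt hR hv hk (h5 _ hi)]
            refine (hA.radius_lt_lam_mul_Sse hk).trans_le ?_
            exact mul_le_mul_of_nonneg_right (le_self_pow₀ hl1.le (by omega)) hS.le
        calc R k * σ * _ < R k * σ * (lam p R k ^ (i + 1) * Sse p R k) :=
              mul_lt_mul_of_pos_left h12 (by positivity)
          _ = _ := by ring
  rw [key _ le_rfl, Admissible.expFactor_succ hk]
  ring

/-! ### Parameters for which a given point is fixed -/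

/-- The parameter of index `q` for which `w` is a fixed point. -/
def fixParam (p : ℕ) (v : ℕ → K) (q : ℕ) (w : K) : K :=
  w⁻¹ - (gf p (Function.update v q 0) w)⁻¹

variable {q : ℕ}

theorem norm_gf_zero_sub_le (hR : IsRadii p R) (hpK : ‖(p : K)‖ = (p : ℝ)⁻¹)
    (hv : InvRadii R v) (hq : 1 ≤ q) (hz : ‖z‖ = R q) (hw : ‖w‖ = R q) :
    ‖gf p (Function.update v q 0) z - gf p (Function.update v q 0) w‖ ≤
      ‖z - w‖ / R q * phi p R (R q) := by
  have hRq := hR.pos hq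
  have h0 := hv.invBound.update_zero hR q
  refine norm_gf_sub_le (σ := 0) hR hpK h0 h0 (fun j _ => by simp) hz.le hw.le
    (by positivity) (by field_simp; exact le_rfl) (by rw [mul_zero]; positivity)

theorem norm_inv_sub_inv_eq {a b : K} (ha : a ≠ 0) (hb : b ≠ 0) :
    ‖a⁻¹ - b⁻¹‖ = ‖a - b‖ / (‖a‖ * ‖b‖) := by
  rw [inv_sub_inv ha hb, norm_div, norm_mul, norm_sub_rev]

theorem gf_zero_ne_zero (hR : IsRadii p R) (hpK : ‖(p : K)‖ = (p : ℝ)⁻¹)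
    (hv : InvRadii R v) (hq : 1 ≤ q) (hz : ‖z‖ = R q) : gf p (Function.update v q 0) z ≠ 0 := by
  rw [← norm_pos_iff, norm_gf_update_zero hR hpK hv hq hz]
  exact phi_pos hR (hR.pos hq)

theorem ne_zero_of_norm_eq_radius (hR : IsRadii p R) (hq : 1 ≤ q) (hz : ‖z‖ = R q) : z ≠ 0 := by
  rw [← norm_pos_iff, hz]
  exact hR.pos hq

theorem norm_fixParam_sub_eq (hR : IsRadii p R) (hpK : ‖(p : K)‖ = (p : ℝ)⁻¹)
    (hv : InvRadii R v) (hq : 1 ≤ q) (hz : ‖z‖ = R q) (hw : ‖w‖ = R q) :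
    ‖fixParam p v q z - fixParam p v q w‖ = ‖z - w‖ / R q ^ 2 := by
  rcases eq_or_ne z w with rfl | hzw
  · simp
  have hRq := hR.pos hq
  have hφ := phi_pos hR hRq
  have hzw0 : 0 < ‖z - w‖ := norm_pos_iff.2 (sub_ne_zero.2 hzw)
  have hlam := one_lt_lam hR hq
  have h1 : ‖z⁻¹ - w⁻¹‖ = ‖z - w‖ / R q ^ 2 := by
    rw [norm_inv_sub_inv_eq (ne_zero_of_norm_eq_radius hR hq hz)
      (ne_zero_of_norm_eq_radius hR hq hw), hz, hw, sq]
  have h2 : ‖(gf p (Function.update v q 0) w)⁻¹ - (gf p (Function.update v q 0) z)⁻¹‖ <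
      ‖z - w‖ / R q ^ 2 := by
    rw [norm_inv_sub_inv_eq (gf_zero_ne_zero hR hpK hv hq hw) (gf_zero_ne_zero hR hpK hv hq hz),
      norm_gf_update_zero hR hpK hv hq hz, norm_gf_update_zero hR hpK hv hq hw, norm_sub_rev]
    calc _ ≤ ‖z - w‖ / R q * phi p R (R q) / (phi p R (R q) * phi p R (R q)) := by
          gcongr
          exact norm_gf_zero_sub_le hR hpK hv hq hz hw
      _ = ‖z - w‖ / R q / (lam p R q * R q) := by
          rw [lam_mul hR hq]
          field_simp
      _ < ‖z - w‖ / R q / (1 * R q) := by gcongr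
      _ = _ := by field_simp
  rw [fixParam, fixParam, show z⁻¹ - (gf p (Function.update v q 0) z)⁻¹ -
    (w⁻¹ - (gf p (Function.update v q 0) w)⁻¹) = (z⁻¹ - w⁻¹) +
      ((gf p (Function.update v q 0) w)⁻¹ - (gf p (Function.update v q 0) z)⁻¹) by ring,
    norm_add_eq_of_lt (h1 ▸ h2), h1]

theorem gf_update_fixParam (hR : IsRadii p R) (hpK : ‖(p : K)‖ = (p : ℝ)⁻¹)
    (hv : InvRadii R v) (hq : 1 ≤ q) (hw : ‖w‖ = R q) :
    gf p (Function.update v q (fixParam p v q w)) w = w := by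
  have h1 := gf_zero_ne_zero hR hpK hv hq hw
  have h2 := ne_zero_of_norm_eq_radius hR hq hw
  rw [gf_update hR hv.invBound hq, fixParam]
  field_simp
  ring

theorem norm_one_sub_fixParam_mul_lt (hR : IsRadii p R) (hpK : ‖(p : K)‖ = (p : ℝ)⁻¹)
    (hv : InvRadii R v) (hq : 1 ≤ q) (hw : ‖w‖ = R q) : ‖1 - fixParam p v q w * w‖ < 1 := by
  have h2 := ne_zero_of_norm_eq_radius hR hq hw
  have h3 : 1 - fixParam p v q w * w = w / gf p (Function.update v q 0) w := by
    rw [fixParam]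
    field_simp
    ring
  rw [h3, norm_div, norm_gf_update_zero hR hpK hv hq hw, hw, div_lt_one (phi_pos hR (hR.pos hq))]
  exact lt_phi_of_one_le hR (one_lt_radius hR hq).le

theorem norm_eq_of_mem_closedBall {a : K} {d : ℝ} (hd : d < ‖a‖) (hw : w ∈ Metric.closedBall a d) :
    ‖w‖ = ‖a‖ := by
  rw [mem_closedBall_iff_norm'] at hw
  exact norm_eq_of_norm_sub_lt (hw.trans_lt hd)

theorem isPolyLimit_fixParam (hR : IsRadii p R) (hpK : ‖(p : K)‖ = (p : ℝ)⁻¹)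
    (hv : InvRadii R v) (hq : 1 ≤ q) {a : K} (ha : ‖a‖ = R q) {d : ℝ} (hd : d < R q) :
    IsPolyLimit (Metric.closedBall a d) (fixParam p v q) := by
  have hD := Metric.isBounded_closedBall (x := a) (r := d)
  have hRq := hR.pos hq
  have hφ := phi_pos hR hRq
  have hθ : d / R q < 1 := (div_lt_one hRq).2 hd
  have h1 : IsPolyLimit (Metric.closedBall a d) fun w => w⁻¹ := by
    refine IsPolyLimit.id.inv hD (ne_zero_of_norm_eq_radius hR hq ha) hθ fun w hw => ?_
    rw [mem_closedBall_iff_norm'] at hw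
    rwa [ha, div_mul_cancel₀ _ hRq.ne']
  refine h1.sub hD ((IsPolyLimit.id.gf_comp hR hpK (hv.invBound.update_zero hR q) hD).inv hD
    (gf_zero_ne_zero hR hpK hv hq ha) hθ fun w hw => ?_)
  have hwR := norm_eq_of_mem_closedBall (ha ▸ hd) hw
  rw [mem_closedBall_iff_norm'] at hw
  refine (norm_gf_zero_sub_le hR hpK hv hq ha (hwR.trans ha)).trans ?_
  rw [norm_gf_update_zero hR hpK hv hq ha]
  gcongr

theorem exists_norm_fixParam_sub_lt [IsAlgClosed K] (hR : IsRadii p R)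
    (hpK : ‖(p : K)‖ = (p : ℝ)⁻¹) (hv : InvRadii R v) (hq : 1 ≤ q) {s : K}
    (hs : ‖s‖ = (R q)⁻¹) {η : ℝ} (hη : 0 < η) :
    ∃ w : K, ‖w‖ = R q ∧ ‖fixParam p v q w - s‖ < η := by
  have hRq := hR.pos hq
  have hlam := one_lt_lam hR hq
  have hp0 := prime_pos_real (p := p)
  have hp2 := two_le_prime_real (p := p)
  obtain ⟨c, hc1, hc2⟩ := exists_norm_mem_Ioo (K := K) (q := (p : K))
    (norm_pos_iff.1 (by rw [hpK]; positivity)) (by rw [hpK]; exact inv_lt_one_of_one_lt₀ (by linarith))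
    (div_pos hRq (zero_lt_one.trans hlam)) (div_lt_self hRq hlam)
  have ha : ‖s⁻¹‖ = R q := by rw [norm_inv, hs, inv_inv]
  have hmem : ∀ w ∈ Metric.closedBall s⁻¹ ‖c‖, ‖w‖ = R q := fun w hw =>
    (norm_eq_of_mem_closedBall (ha ▸ hc2) hw).trans ha
  have hc : s⁻¹ + c ∈ Metric.closedBall s⁻¹ ‖c‖ := by simp
  have h0 : s⁻¹ ∈ Metric.closedBall s⁻¹ ‖c‖ := by simp
  have h1 : ‖fixParam p v q s⁻¹ - s‖ = R q / lam p R q / R q ^ 2 := by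
    rw [fixParam, inv_inv, sub_sub_cancel_left, norm_neg, norm_inv,
      norm_gf_update_zero hR hpK hv hq ha, ← lam_mul hR hq]
    field_simp
  have h2 : ‖fixParam p v q (s⁻¹ + c) - fixParam p v q s⁻¹‖ = ‖c‖ / R q ^ 2 := by
    rw [norm_fixParam_sub_eq hR hpK hv hq (hmem _ hc) ha, add_sub_cancel_left]
  have h3 : ‖fixParam p v q s⁻¹ - s‖ < ‖c‖ / R q ^ 2 := by
    rw [h1]
    gcongr
  have h4 : ‖fixParam p v q (s⁻¹ + c) - s‖ = ‖c‖ / R q ^ 2 := by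
    rw [← sub_add_sub_cancel _ (fixParam p v q s⁻¹), norm_add_eq_of_lt (h2 ▸ h3), h2]
  obtain ⟨w, hw, hws⟩ := ((isPolyLimit_fixParam hR hpK hv hq ha hc2).sub
    Metric.isBounded_closedBall (.const s)).exists_norm_lt h0 hc (h4 ▸ h3) hη
  exact ⟨w, hmem w hw, hws⟩

end Perturb

/-! ### Adjusting the parameters one block at a time -/

section Adjust

variable {K : Type*} [NormedField K] [IsUltrametricDist K] [CompleteSpace K]
  {p : ℕ} [hp : Fact p.Prime] {R r : ℕ → ℝ} {m l : ℕ → ℕ} {v : ℕ → K} {x : K} {k : ℕ}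

theorem norm_eq_of_norm_sub_le_paramRadius (hA : Admissible p R m l r) (hv : InvRadii R v)
    (hk : 1 ≤ k) {s : K} (hs : ‖v (k + 1) - s‖ ≤ paramRadius p R l k) :
    ‖s‖ = (R (k + 1))⁻¹ := by
  rw [← hv (k + 1) (by omega)]
  refine norm_eq_of_norm_sub_lt (hs.trans_lt ?_)
  rw [hv (k + 1) (by omega)]
  exact hA.paramRadius_lt_inv hk

theorem FollowsBlocks.update (hA : Admissible p R m l r) (hpK : ‖(p : K)‖ = (p : ℝ)⁻¹)
    (hv : InvRadii R v) (hk : 1 ≤ k) (hx : FollowsBlocks p R m l r v x k)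
    (hend : ‖(gf p v)^[Lseq m (nseq p R) l (k + 1)] x‖ ≤ p * R k) {s : K}
    (hs : ‖v (k + 1) - s‖ ≤ paramRadius p R l k) :
    FollowsBlocks p R m l r (Function.update v (k + 1) s) x k ∧
      ‖(gf p (Function.update v (k + 1) s))^[Lseq m (nseq p R) l (k + 1)] x‖ ≤ p * R k := by
  have hv' := hv.update (norm_eq_of_norm_sub_le_paramRadius hA hv hk hs)
  obtain ⟨h1, h2⟩ := FollowsBlocks.compare (y := x) (d := 0) hA hpK hv hv' hk
    (hA.paramRadius_pos hk).le le_rfl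
    (fun j _ => (norm_update_sub_le v (k + 1) s j).trans hs)
    (fun j _ hj => by rw [Function.update_of_ne (by omega)]) hx hend (sq_nonneg _) (by simp)
  refine ⟨h1, ?_⟩
  have h3 := h2 (k + 1) (by omega) le_rfl
  rw [hA.expFactor_succ_mul hk] at h3
  have h4 : 0 ≤ p * R k := mul_nonneg prime_pos_real.le (hA.radii.pos hk).le
  rw [max_eq_right h4] at h3
  rw [← sub_sub_cancel ((gf p v)^[Lseq m (nseq p R) l (k + 1)] x)
    ((gf p (Function.update v (k + 1) s))^[Lseq m (nseq p R) l (k + 1)] x)]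
  exact (norm_sub_le_max' _ _).trans (max_le hend h3)

theorem norm_endpoint_update_sub_update_eq (hA : Admissible p R m l r)
    (hpK : ‖(p : K)‖ = (p : ℝ)⁻¹) (hv : InvRadii R v) (hk : 1 ≤ k)
    (hx : FollowsBlocks p R m l r v x k)
    (hend : ‖(gf p v)^[Lseq m (nseq p R) l (k + 1)] x‖ ≤ p * R k) {s t : K}
    (hs : ‖v (k + 1) - s‖ ≤ paramRadius p R l k) (ht : ‖v (k + 1) - t‖ ≤ paramRadius p R l k) :
    ‖(gf p (Function.update v (k + 1) s))^[Lseq m (nseq p R) l (k + 1)] x -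
      (gf p (Function.update v (k + 1) t))^[Lseq m (nseq p R) l (k + 1)] x‖ =
        expFactor p R l (k + 1) * ‖s - t‖ := by
  obtain ⟨h1, h2⟩ := hx.update hA hpK hv hk hend hs
  have hv1 := hv.update (norm_eq_of_norm_sub_le_paramRadius hA hv hk hs)
  have hv2 := hv.update (norm_eq_of_norm_sub_le_paramRadius hA hv hk ht)
  have h3 := norm_endpoint_sub_update_eq (t := t) hA hpK hv1 hk
    (by rwa [Function.update_idem]) (by
      rw [Function.update_self]
      exact norm_sub_trans (by rwa [norm_sub_rev]) ht) h1 h2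
  rwa [Function.update_idem, Function.update_self] at h3

theorem exists_norm_mem_Ioo_of_prime [IsAlgClosed K] (hpK : ‖(p : K)‖ = (p : ℝ)⁻¹) {a b : ℝ}
    (ha : 0 < a) (hab : a < b) : ∃ z : K, a < ‖z‖ ∧ ‖z‖ < b := by
  have hp0 := prime_pos_real (p := p)
  have hp2 := two_le_prime_real (p := p)
  exact exists_norm_mem_Ioo (q := (p : K)) (norm_pos_iff.1 (by rw [hpK]; positivity))
    (by rw [hpK]; exact inv_lt_one_of_one_lt₀ (by linarith)) ha hab

/-- The start of block `k + 1` can be made small by changing the parameter of index `k + 1`. -/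
theorem FollowsBlocks.exists_norm_endpoint_lt [IsAlgClosed K] (hA : Admissible p R m l r)
    (hpK : ‖(p : K)‖ = (p : ℝ)⁻¹) (hv : InvRadii R v) (hk : 1 ≤ k)
    (hx : FollowsBlocks p R m l r v x k)
    (hend : ‖(gf p v)^[Lseq m (nseq p R) l (k + 1)] x‖ ≤ R k) {δ : ℝ} (hδ : 0 < δ) :
    ∃ s : K, ‖v (k + 1) - s‖ ≤ paramRadius p R l k ∧
      ‖(gf p (Function.update v (k + 1) s))^[Lseq m (nseq p R) l (k + 1)] x‖ < δ := by
  have hRk := hA.radii.pos hk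
  have hp2 := two_le_prime_real (p := p)
  have hE := hA.expFactor_succ_pos hk
  have hEσ := hA.expFactor_succ_mul hk
  have hend' : ‖(gf p v)^[Lseq m (nseq p R) l (k + 1)] x‖ ≤ p * R k := hend.trans (by nlinarith)
  obtain ⟨c, hc1, hc2⟩ := exists_norm_mem_Ioo_of_prime (K := K) hpK (div_pos hRk hE)
    (b := paramRadius p R l k) (by rw [div_lt_iff₀ hE, mul_comm, hEσ]; nlinarith)
  rw [div_lt_iff₀ hE, mul_comm] at hc1
  have hmem : ∀ s ∈ Metric.closedBall (v (k + 1)) ‖c‖, ‖v (k + 1) - s‖ ≤ paramRadius p R l k :=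
    fun s hs => (mem_closedBall_iff_norm'.1 hs).trans hc2.le
  have h0 : v (k + 1) ∈ Metric.closedBall (v (k + 1)) ‖c‖ := by simp
  have hc : v (k + 1) + c ∈ Metric.closedBall (v (k + 1)) ‖c‖ := by simp
  have h1 := norm_endpoint_update_sub_update_eq hA hpK hv hk hx hend' (hmem _ hc) (hmem _ h0)
  rw [add_sub_cancel_left] at h1
  have h2 : ‖(gf p (Function.update v (k + 1) (v (k + 1))))^[Lseq m (nseq p R) l (k + 1)] x‖ ≤
      R k := by rwa [Function.update_eq_self]
  have h3 := h2.trans_lt hc1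
  have h4 : ‖(gf p (Function.update v (k + 1) (v (k + 1) + c)))^[Lseq m (nseq p R) l (k + 1)] x‖ =
      expFactor p R l (k + 1) * ‖c‖ := by
    rw [← h1] at h3
    rw [← h1, ← norm_add_eq_of_lt h3, sub_add_cancel]
  obtain ⟨s, hs, hsδ⟩ := (IsPolyLimit.id.iterate_update hA.radii hpK hv.invBound
    Metric.isBounded_closedBall (by omega : 1 ≤ k + 1) x _).exists_norm_lt h0 hc (h4 ▸ h3) hδ
  exact ⟨s, hmem s hs, hsδ⟩

/-- An orbit shadowing a fixed point in `B_k` closely enough follows the `k`-th block. -/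
theorem FollowsBlock.of_fixed_point (hA : Admissible p R m l r) (hpK : ‖(p : K)‖ = (p : ℝ)⁻¹)
    (hv : InvRadii R v) (hk : 1 ≤ k) {z w : K} (hz : ‖z‖ = r k) (hfix : gf p v w = w)
    (hw : ‖1 - v k * w‖ < 1)
    (hwz : ‖w - (gf p v)^[m k + nseq p R k] z‖ < R k / lam p R k ^ l (k + 1)) :
    FollowsBlock p R m l r v k z ∧
      ‖(gf p v)^[l (k + 1)] ((gf p v)^[m k + nseq p R k] z)‖ = R k := by
  have hR := hA.radii
  have hlam := lam_pos hR hk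
  have hl1 := one_lt_lam hR hk
  have hRk := hR.pos hk
  rw [lt_div_iff₀ (by positivity), mul_comm] at hwz
  have hw' : ∀ i, (gf p v)^[i] w = w := fun i => Function.iterate_fixed hfix i
  set y := (gf p v)^[m k + nseq p R k] z
  have hsmall : ∀ i ≤ l (k + 1), lam p R k ^ i * ‖w - y‖ < R k := fun i hi =>
    (mul_le_mul_of_nonneg_right (pow_le_pow_right₀ hl1.le hi) (norm_nonneg _)).trans_lt hwz
  have h := fun i hi => norm_iterate_sub_le_of_mem_disk (σ := 0) (i := i) (n := l (k + 1))
    (w := y) hR hpK hv hv hk (fun j _ => by simp) rfl (fun i _ => by rwa [hw']) le_rfl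
    (fun i hi => hsmall i hi.le) (by rw [mul_zero, zero_mul]; positivity)
    (by rw [mul_zero, zero_mul]; positivity) hi
  have h' : ∀ i ≤ l (k + 1), ‖w - (gf p v)^[i] y‖ < R k := fun i hi => by
    have := (h i hi).trans_lt (hsmall i hi)
    rwa [hw'] at this
  have hwR := norm_eq_of_norm_one_sub_lt hR hv hk hw
  refine ⟨⟨hz, fun i hi => norm_one_sub_lt_of_norm_sub_lt hR hv hk hw (h' i hi.le)⟩, ?_⟩
  rw [← hwR]
  exact norm_eq_of_norm_sub_lt (by rw [hwR]; exact h' _ le_rfl)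

theorem norm_passage_lt (hA : Admissible p R m l r) (hpK : ‖(p : K)‖ = (p : ℝ)⁻¹)
    (hv : InvRadii R v) (hk : 1 ≤ k) {z : K} (hz : ‖z‖ < r k) :
    ‖(gf p v)^[m k + nseq p R k] z‖ < R k := by
  obtain ⟨t, ht1, ht2⟩ := exists_between (max_lt hz (hA.entry k hk).pos)
  rw [← (hA.entry k hk).iter_eq]
  exact (norm_iterate_gf_le hA.radii hpK hv.invBound ((le_max_left _ _).trans ht1.le) _).trans_lt
    (phi_iterate_lt hA.radii ((le_max_right _ _).trans_lt ht1) ht2 _)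

/-- The inductive step: adjust the parameter of index `k + 1` so that the orbit of `x` follows one
more block. -/
theorem FollowsBlocks.exists_succ [IsAlgClosed K] (hA : Admissible p R m l r)
    (hpK : ‖(p : K)‖ = (p : ℝ)⁻¹) (hv : InvRadii R v) (hk : 1 ≤ k)
    (hx : FollowsBlocks p R m l r v x k)
    (hend : ‖(gf p v)^[Lseq m (nseq p R) l (k + 1)] x‖ ≤ R k) :
    ∃ s : K, ‖v (k + 1) - s‖ ≤ paramRadius p R l k ∧
      FollowsBlocks p R m l r (Function.update v (k + 1) s) x (k + 1) ∧
      ‖(gf p (Function.update v (k + 1) s))^[Lseq m (nseq p R) l (k + 2)] x‖ ≤ R (k + 1) := by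
  have hR := hA.radii
  have hRk := hR.pos hk
  have hRk1 := one_lt_radius hR hk
  have hp2 := two_le_prime_real (p := p)
  have hE := hA.expFactor_succ_pos hk
  have hEσ := hA.expFactor_succ_mul hk
  have hend' : ‖(gf p v)^[Lseq m (nseq p R) l (k + 1)] x‖ ≤ p * R k := hend.trans (by nlinarith)
  have hq : 1 ≤ k + 1 := by omega
  have hRq := hR.pos hq
  have hlam := lam_pos hR hq
  have he := hA.entry (k + 1) hq
  have hr0 := he.pos
  have hr1 : r (k + 1) < 1 := he.iter_lt_one 0 (hA.one_le_m _ hq)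
  have hσ0 := hA.paramRadius_pos hk
  have hσ1 := hA.paramRadius_lt_inv hk
  have hscale := fun s t (hs : ‖v (k + 1) - s‖ ≤ _) (ht : ‖v (k + 1) - t‖ ≤ _) =>
    norm_endpoint_update_sub_update_eq hA hpK hv hk hx hend' hs ht
  set q := k + 1
  set E := expFactor p R l q
  set F : K → K := fun s => (gf p (Function.update v q s))^[Lseq m (nseq p R) l q] x with hF
  set X : K → K := fun s => (gf p (Function.update v q s))^[m q + nseq p R q] (F s) with hX
  -- a parameter close to `v q` for which the start of the next block is small
  obtain ⟨s₁, hs₁, hFs₁⟩ := hx.exists_norm_endpoint_lt hA hpK hv hk hend hr0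
  obtain ⟨w₁, hw₁, hsw₁⟩ := exists_norm_fixParam_sub_lt hR hpK hv hq
    (norm_eq_of_norm_sub_le_paramRadius hA hv hk hs₁) (lt_min hσ0 (div_pos hr0 hE))
  have hw₁σ : ‖v q - fixParam p v q w₁‖ ≤ paramRadius p R l k :=
    norm_sub_trans hs₁ (by rw [norm_sub_rev]; exact hsw₁.le.trans (min_le_left _ _))
  have hFw₁ : ‖F (fixParam p v q w₁)‖ < r q := by
    rw [← sub_add_cancel (F (fixParam p v q w₁)) (F s₁)]
    refine (IsUltrametricDist.norm_add_le_max _ _).trans_lt (max_lt ?_ hFs₁)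
    have h := hsw₁.trans_le (min_le_right _ _)
    rw [lt_div_iff₀ hE, mul_comm] at h
    exact (hscale _ _ hw₁σ hs₁).trans_lt h
  -- a disk of fixed points around `w₁`
  obtain ⟨r₁, hr₁, hr₁'⟩ := he.exists_gt hR hq
  obtain ⟨c, hc1, hc2⟩ := exists_norm_mem_Ioo_of_prime (K := K) hpK
    (a := R q ^ 2 * r q / E) (b := R q ^ 2 * min r₁ 1 / E) (by positivity)
    (by gcongr; exact lt_min hr₁ hr1)
  rw [lt_div_iff₀ hE] at hc2
  rw [div_lt_iff₀ hE] at hc1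
  have hcr₁ : E * (‖c‖ / R q ^ 2) < r₁ := by
    rw [← mul_div_assoc, div_lt_iff₀ (by positivity)]
    nlinarith [min_le_left r₁ 1, sq_nonneg (R q)]
  have hcr : r q < E * (‖c‖ / R q ^ 2) := by
    rw [← mul_div_assoc, lt_div_iff₀ (by positivity)]
    linarith
  have hcσ : ‖c‖ / R q ^ 2 ≤ paramRadius p R l k := by
    refine le_of_mul_le_mul_left ?_ hE
    rw [hEσ, ← mul_div_assoc, div_le_iff₀ (by positivity)]
    have h1 : E * ‖c‖ ≤ R q ^ 2 := by nlinarith [min_le_right r₁ 1, sq_nonneg (R q)]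
    have h2 : 1 ≤ p * R k := by nlinarith
    nlinarith [sq_nonneg (R q)]
  have hcR : ‖c‖ < R q := by
    have h := hcσ.trans_lt hσ1
    rw [div_lt_iff₀ (by positivity)] at h
    calc ‖c‖ < (R q)⁻¹ * R q ^ 2 := h
      _ = R q := by field_simp
  have hmem : ∀ w ∈ Metric.closedBall w₁ ‖c‖, ‖w‖ = R q := fun w hw =>
    (norm_eq_of_mem_closedBall (hw₁ ▸ hcR) hw).trans hw₁
  have hdist : ∀ w ∈ Metric.closedBall w₁ ‖c‖,
      ‖fixParam p v q w - fixParam p v q w₁‖ ≤ ‖c‖ / R q ^ 2 := fun w hw => by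
    rw [norm_fixParam_sub_eq hR hpK hv hq (hmem w hw) hw₁]
    gcongr
    exact mem_closedBall_iff_norm.1 hw
  have hparam : ∀ w ∈ Metric.closedBall w₁ ‖c‖,
      ‖v q - fixParam p v q w‖ ≤ paramRadius p R l k := fun w hw =>
    norm_sub_trans hw₁σ (by rw [norm_sub_rev]; exact (hdist w hw).trans hcσ)
  have hrad : ∀ w ∈ Metric.closedBall w₁ ‖c‖,
      InvRadii R (Function.update v q (fixParam p v q w)) := fun w hw =>
    hv.update (norm_eq_of_norm_sub_le_paramRadius hA hv hk (hparam w hw))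
  have hFle : ∀ w ∈ Metric.closedBall w₁ ‖c‖, ‖F (fixParam p v q w)‖ ≤ r₁ := fun w hw => by
    rw [← sub_add_cancel (F (fixParam p v q w)) (F (fixParam p v q w₁))]
    refine (IsUltrametricDist.norm_add_le_max _ _).trans (max_le ?_ (hFw₁.trans hr₁).le)
    refine (hscale _ _ (hparam w hw) hw₁σ).trans_le (le_trans ?_ hcr₁.le)
    exact mul_le_mul_of_nonneg_left (hdist w hw) hE.le
  have hXgt : ∀ w ∈ Metric.closedBall w₁ ‖c‖, r q < ‖F (fixParam p v q w)‖ →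
      R q < ‖X (fixParam p v q w)‖ := fun w hw hgt => by
    rw [← he.iter_eq]
    refine lt_of_lt_of_eq (phi_iterate_lt hR hr0 hgt _) (norm_iterate_gf_eq hR hpK (hrad w hw) ?_).symm
    exact hr₁' _ hgt.le (hFle w hw)
  have h0 : w₁ ∈ Metric.closedBall w₁ ‖c‖ := by simp
  have hc : w₁ + c ∈ Metric.closedBall w₁ ‖c‖ := by simp
  have hF₂ : r q < ‖F (fixParam p v q (w₁ + c))‖ := by
    have h1 := hscale _ _ (hparam _ hc) hw₁σ
    rw [norm_fixParam_sub_eq hR hpK hv hq (hmem _ hc) hw₁, add_sub_cancel_left] at h1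
    have h2 := norm_add_eq_of_lt (h1.symm ▸ hFw₁.trans hcr :
      ‖F (fixParam p v q w₁)‖ < ‖F (fixParam p v q (w₁ + c)) - F (fixParam p v q w₁)‖)
    rw [sub_add_cancel] at h2
    rw [h2]
    exact h1.symm ▸ hcr
  have hX₁ : ‖X (fixParam p v q w₁)‖ < R q := norm_passage_lt hA hpK (hrad w₁ h0) hq hFw₁
  have hh₁ : ‖w₁ - X (fixParam p v q w₁)‖ = R q := by
    rw [← hw₁, sub_eq_add_neg]
    exact norm_add_eq_of_lt (by rwa [norm_neg, hw₁])
  have hh₂ : R q < ‖w₁ + c - X (fixParam p v q (w₁ + c))‖ := by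
    have h1 := hXgt _ hc hF₂
    have h2 : ‖w₁ + c‖ < ‖-X (fixParam p v q (w₁ + c))‖ := by rwa [norm_neg, hmem _ hc]
    rw [sub_eq_add_neg, add_comm (w₁ + c), norm_add_eq_of_lt h2, norm_neg]
    exact h1
  have hpoly : IsPolyLimit (Metric.closedBall w₁ ‖c‖) fun w => w - X (fixParam p v q w) := by
    have h1 := (isPolyLimit_fixParam hR hpK hv hq hw₁ hcR).iterate_update hR hpK hv.invBound
      Metric.isBounded_closedBall hq x (m q + nseq p R q + Lseq m (nseq p R) l q)
    simp only [Function.iterate_add_apply _ (m q + nseq p R q)] at h1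
    exact IsPolyLimit.id.sub Metric.isBounded_closedBall h1
  obtain ⟨w, hw, hwX⟩ := hpoly.exists_norm_lt h0 hc (hh₁.trans_lt hh₂)
    (δ := R q / lam p R q ^ l (q + 1)) (by positivity)
  have hwR := hmem w hw
  have hXw : ‖X (fixParam p v q w)‖ = R q := by
    rw [← hwR]
    refine norm_eq_of_norm_sub_lt (hwX.trans_le ?_)
    rw [hwR]
    exact div_le_self hRq.le (one_le_pow₀ (one_lt_lam hR hq).le)
  have hFw : ‖F (fixParam p v q w)‖ = r q := by
    rcases lt_trichotomy ‖F (fixParam p v q w)‖ (r q) with h | h | h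
    · exact absurd hXw (norm_passage_lt hA hpK (hrad w hw) hq h).ne
    · exact h
    · exact absurd hXw (hXgt w hw h).ne'
  obtain ⟨h1, h2⟩ := FollowsBlock.of_fixed_point hA hpK (hrad w hw) hq hFw
    (gf_update_fixParam hR hpK hv hq hwR)
    (by rw [Function.update_self]; exact norm_one_sub_fixParam_mul_lt hR hpK hv hq hwR) hwX
  refine ⟨fixParam p v q w, hparam w hw, fun j hj hjq => ?_, ?_⟩
  · rcases hjq.eq_or_lt with rfl | hlt
    · exact h1
    · exact (hx.update hA hpK hv hk hend' (hparam w hw)).1 j hj (by omega)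
  · rw [iterate_Lseq_succ _ hq]
    exact h2.le

end Adjust

/-! ### Disks and itineraries -/

theorem Lseq_succ (m n l : ℕ → ℕ) {k : ℕ} (hk : 1 ≤ k) :
    Lseq m n l (k + 1) = Lseq m n l k + m k + n k + l (k + 1) := by
  obtain ⟨k, rfl⟩ := Nat.exists_eq_add_of_le' hk
  rfl

theorem le_Lseq {m n l : ℕ → ℕ} (hl : ∀ j, 2 ≤ j → 1 ≤ l j) {k : ℕ} (hk : 1 ≤ k) :
    k ≤ Lseq m n l k + 1 := by
  induction k, hk using Nat.le_induction with
  | base => omega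
  | succ k hk ih =>
    have := hl (k + 1) (by omega)
    rw [Lseq_succ m n l hk]
    omega

/-- Every position lies in a unique block, which determines its symbol. -/
theorem exists_block {m n l : ℕ → ℕ} (hl : ∀ j, 2 ≤ j → 1 ≤ l j) (i : ℕ) :
    ∃ k, 1 ≤ k ∧ Lseq m n l k ≤ i ∧ i < Lseq m n l (k + 1) ∧
      itin m n l i = if i < Lseq m n l k + m k then some 0
        else if i < Lseq m n l k + m k + n k then none else some k := by
  have hne : {k : ℕ | 1 ≤ k ∧ Lseq m n l k ≤ i}.Nonempty := ⟨1, le_rfl, Nat.zero_le i⟩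
  have hbdd : BddAbove {k : ℕ | 1 ≤ k ∧ Lseq m n l k ≤ i} := ⟨i + 1, fun k hk => by
    have h1 := le_Lseq (m := m) (n := n) hl hk.1
    have h2 := hk.2
    omega⟩
  obtain ⟨h1, h2⟩ := Nat.sSup_mem hne hbdd
  refine ⟨_, h1, h2, ?_, rfl⟩
  by_contra! h
  exact absurd (le_csSup hbdd (show _ ∈ {k : ℕ | 1 ≤ k ∧ Lseq m n l k ≤ i} from
    ⟨by omega, h⟩)) (by omega)

section Main

variable {K : Type*} [NormedField K] [IsUltrametricDist K] [CompleteSpace K]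
  {p : ℕ} [hp : Fact p.Prime] {R r ε : ℕ → ℝ} {m l : ℕ → ℕ} {v c : ℕ → K} {x y z : K} {k : ℕ}

theorem mem_Bset_iff (hR : IsRadii p R) (hc : InC p R c) {j : ℕ} (hj : 1 ≤ j) :
    z ∈ Bset R c j ↔ ‖1 - (c j)⁻¹ * z‖ < 1 := by
  have hRj := hR.pos hj
  have hcj : c j ≠ 0 := norm_pos_iff.1 ((hc j hj).symm ▸ hRj)
  have h : z - c j = -(c j * (1 - (c j)⁻¹ * z)) := by
    field_simp
    ring
  rw [Bset, if_neg (by omega), Set.mem_ofPred_eq, h, norm_neg, norm_mul, hc j hj]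
  exact mul_lt_iff_lt_one_right hRj

theorem mem_Bset_zero_iff : z ∈ Bset R c 0 ↔ ‖z‖ < 1 := by
  rw [Bset, if_pos rfl, Set.mem_ofPred_eq]

theorem mem_Aset_iff : z ∈ Aset R c ↔ ∀ j, z ∉ Bset R c j := by
  simp [Aset]

theorem InC.invRadii (hc : InC p R c) : InvRadii R fun j => (c j)⁻¹ := fun j hj => by
  rw [norm_inv, hc j hj]

theorem InvRadii.inC (hv : InvRadii R v) : InC p R fun j => (v j)⁻¹ := fun j hj => by
  rw [norm_inv, hv j hj, inv_inv]

theorem norm_gf_eq_of_one_le (hR : IsRadii p R) (hpK : ‖(p : K)‖ = (p : ℝ)⁻¹) (hv : InvRadii R v)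
    (h : ∀ j, 1 ≤ j → 1 ≤ ‖1 - v j * z‖) : ‖gf p v z‖ = phi p R ‖z‖ := by
  refine norm_gf_eq hR hpK hv.invBound fun j hj => ?_
  by_cases hz : ‖z‖ = R j
  · refine le_antisymm (norm_one_sub_le_max _ (hv.invBound.norm_mul_le hR hj le_rfl)) ?_
    rw [hz, div_self (hR.pos hj).ne', max_self]
    exact h j hj
  · exact norm_one_sub_eq_of_ne hR hv hj hz

/-- A point with itinerary `B_0^{m_1} A^{n_1} B_1^∞` follows the first block. -/
theorem followsBlocks_one (hA : Admissible p R m l r) (hpK : ‖(p : K)‖ = (p : ℝ)⁻¹)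
    (hc : InC p R c)
    (hx0 : ∀ n, n < m 1 → (fc p c)^[n] x ∈ Bset R c 0)
    (hxA : ∀ n, m 1 ≤ n → n < m 1 + nseq p R 1 → (fc p c)^[n] x ∈ Aset R c)
    (hx1 : ∀ n, m 1 + nseq p R 1 ≤ n → (fc p c)^[n] x ∈ Bset R c 1) :
    FollowsBlocks p R m l r (fun j => (c j)⁻¹) x 1 ∧
      ‖(gf p fun j => (c j)⁻¹)^[Lseq m (nseq p R) l 2] x‖ ≤ R 1 := by
  have hR := hA.radii
  have hv := hc.invRadii
  simp only [fc_eq_gf] at hx0 hxA hx1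
  have hone : ∀ n < m 1 + nseq p R 1, ∀ j, 1 ≤ j →
      1 ≤ ‖1 - (c j)⁻¹ * (gf p fun j => (c j)⁻¹)^[n] x‖ := fun n hn j hj => by
    rcases lt_or_ge n (m 1) with h | h
    · have h1 := mem_Bset_zero_iff.1 (hx0 n h)
      exact (norm_one_sub_eq_of_lt hR hv.invBound hj (h1.trans (one_lt_radius hR hj))).ge
    · have h1 := mem_Aset_iff.1 (hxA n h hn) j
      rwa [mem_Bset_iff hR hc hj, not_lt] at h1
  have hiter : ∀ n ≤ m 1 + nseq p R 1,
      ‖(gf p fun j => (c j)⁻¹)^[n] x‖ = (phi p R)^[n] ‖x‖ := fun n => by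
    induction n with
    | zero => exact fun _ => rfl
    | succ n ih =>
      intro hn
      rw [Function.iterate_succ_apply', Function.iterate_succ_apply', ← ih (by omega)]
      exact norm_gf_eq_of_one_le hR hpK hv (hone n (by omega))
  have hB : ∀ n, m 1 + nseq p R 1 ≤ n →
      ‖1 - (c 1)⁻¹ * (gf p fun j => (c j)⁻¹)^[n] x‖ < 1 := fun n hn =>
    (mem_Bset_iff hR hc le_rfl).1 (hx1 n hn)
  have hnorm : ∀ n, m 1 + nseq p R 1 ≤ n → ‖(gf p fun j => (c j)⁻¹)^[n] x‖ = R 1 := fun n hn =>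
    norm_eq_of_norm_one_sub_lt hR hv le_rfl (hB n hn)
  have he := hA.entry 1 le_rfl
  have hx : x ≠ 0 := by
    rintro rfl
    have h := hnorm _ le_rfl
    rw [Function.iterate_fixed (by simp [gf, hp.out.ne_zero]), norm_zero] at h
    exact (hR.pos le_rfl).ne h
  have hxr : ‖x‖ = r 1 := phi_iterate_inj hR (norm_pos_iff.2 hx) he.pos (m 1 + nseq p R 1)
    (by rw [he.iter_eq, ← hiter _ le_rfl, hnorm _ le_rfl])
  refine ⟨fun j hj hj1 => ?_, (hnorm _ ?_).le⟩
  · obtain rfl : j = 1 := by omega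
    refine ⟨hxr, fun i _ => ?_⟩
    rw [← Function.iterate_add_apply]
    exact hB (i + (m 1 + nseq p R 1)) (by omega)
  · rw [Lseq_succ m _ l le_rfl]
    omega

/-- Infinitely many parameter adjustments produce a map under which a whole disk around `x`
follows all blocks. -/
theorem FollowsBlocks.exists_forall [IsAlgClosed K] (hA : Admissible p R m l r)
    (hpK : ‖(p : K)‖ = (p : ℝ)⁻¹) (hv : InvRadii R v) (hx : FollowsBlocks p R m l r v x 1)
    (hend : ‖(gf p v)^[Lseq m (nseq p R) l 2] x‖ ≤ R 1) :
    ∃ u : ℕ → K, InvRadii R u ∧ u 1 = v 1 ∧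
      (∀ k, 1 ≤ k → ‖v (k + 1) - u (k + 1)‖ ≤ paramRadius p R l k) ∧
      ∀ y, ‖y - x‖ < rho p ^ 2 → ∀ k, 1 ≤ k → FollowsBlocks p R m l r u y k := by
  have hp2 := two_le_prime_real (p := p)
  have hstep : ∀ (k : ℕ) (w : ℕ → K), ∃ s : K, 1 ≤ k → InvRadii R w →
      FollowsBlocks p R m l r w x k → ‖(gf p w)^[Lseq m (nseq p R) l (k + 1)] x‖ ≤ R k →
      ‖w (k + 1) - s‖ ≤ paramRadius p R l k ∧
      FollowsBlocks p R m l r (Function.update w (k + 1) s) x (k + 1) ∧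
      ‖(gf p (Function.update w (k + 1) s))^[Lseq m (nseq p R) l (k + 2)] x‖ ≤ R (k + 1) := by
    intro k w
    by_cases h : 1 ≤ k ∧ InvRadii R w ∧ FollowsBlocks p R m l r w x k ∧
        ‖(gf p w)^[Lseq m (nseq p R) l (k + 1)] x‖ ≤ R k
    · obtain ⟨s, hs⟩ := h.2.2.1.exists_succ hA hpK h.2.1 h.1 h.2.2.2
      exact ⟨s, fun _ _ _ _ => hs⟩
    · exact ⟨0, fun h1 h2 h3 h4 => absurd ⟨h1, h2, h3, h4⟩ h⟩
  choose S hS using hstep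
  let w : ℕ → ℕ → K := fun n =>
    Nat.rec v (fun n u => Function.update u (n + 2) (S (n + 1) u)) n
  have hwsucc : ∀ n, w (n + 1) = Function.update (w n) (n + 2) (S (n + 1) (w n)) := fun _ => rfl
  have hw : ∀ n, InvRadii R (w n) ∧ FollowsBlocks p R m l r (w n) x (n + 1) ∧
      ‖(gf p (w n))^[Lseq m (nseq p R) l (n + 2)] x‖ ≤ R (n + 1) := fun n => by
    induction n with
    | zero => exact ⟨hv, hx, hend⟩
    | succ n ih =>
      obtain ⟨h1, h2, h3⟩ := hS (n + 1) (w n) (by omega) ih.1 ih.2.1 ih.2.2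
      exact ⟨ih.1.update (norm_eq_of_norm_sub_le_paramRadius hA ih.1 (by omega) h1), h2, h3⟩
  have hold : ∀ n j, n + 1 < j → w n j = v j := fun n => by
    induction n with
    | zero => exact fun _ _ => rfl
    | succ n ih =>
      intro j hj
      rw [hwsucc, Function.update_of_ne (by omega), ih j (by omega)]
  have hstable : ∀ n d j, j ≤ n + 1 → w (n + d) j = w n j := fun n d => by
    induction d with
    | zero => exact fun _ _ => rfl
    | succ d ih =>
      intro j hj
      rw [← add_assoc, hwsucc, Function.update_of_ne (by omega), ih j hj]
  let u : ℕ → K := fun j => w (j - 1) j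
  have hagree : ∀ n j, 1 ≤ j → j ≤ n + 1 → w n j = u j := fun n j hj hjn => by
    have h := hstable (j - 1) (n - (j - 1)) j (by omega)
    rwa [show j - 1 + (n - (j - 1)) = n by omega] at h
  have hu : InvRadii R u := fun j hj => (hw (j - 1)).1 j hj
  have hdist : ∀ n, ‖v (n + 2) - u (n + 2)‖ ≤ paramRadius p R l (n + 1) := fun n => by
    have h1 := (hS (n + 1) (w n) (by omega) (hw n).1 (hw n).2.1 (hw n).2.2).1
    have h2 : u (n + 2) = S (n + 1) (w n) := by
      change w (n + 1) (n + 2) = _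
      rw [hwsucc, Function.update_self]
    rwa [h2, ← hold n (n + 2) (by omega)]
  refine ⟨u, hu, rfl, fun k hk => ?_, fun y hy k hk => ?_⟩
  · obtain ⟨n, rfl⟩ := Nat.exists_eq_add_of_le' hk
    exact hdist n
  · obtain ⟨n, rfl⟩ := Nat.exists_eq_add_of_le' hk
    obtain ⟨h1, h2, h3⟩ := hw n
    have hσ0 := (hA.paramRadius_pos hk).le
    refine (FollowsBlocks.compare hA hpK h1 hu hk hσ0 le_rfl (fun j hj => ?_) (hagree n) h2
      (h3.trans ?_) hy.le (norm_sub_rev x y).le).1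
    · rcases le_or_gt j (n + 1) with h | h
      · rw [hagree n j hj h, sub_self, norm_zero]
        exact hσ0
      · obtain ⟨i, rfl⟩ := Nat.exists_eq_add_of_le' (by omega : 2 ≤ j)
        rw [hold n _ h]
        exact (hdist i).trans (hA.paramRadius_anti hk (by omega))
    · have := hA.radii.pos hk
      nlinarith

/-- A point whose orbit follows all blocks has the prescribed itinerary. -/
theorem mem_symbSet_of_followsBlocks (hA : Admissible p R m l r) (hpK : ‖(p : K)‖ = (p : ℝ)⁻¹)
    (hl : ∀ j, 2 ≤ j → 1 ≤ l j) (hc : InC p R c)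
    (hy : ∀ k, 1 ≤ k → FollowsBlocks p R m l r (fun j => (c j)⁻¹) y k) (i : ℕ) :
    (fc p c)^[i] y ∈ symbSet R c (itin m (nseq p R) l i) := by
  have hR := hA.radii
  have hv := hc.invRadii
  obtain ⟨k, hk, hLi, hiL, hitin⟩ := exists_block (m := m) (n := nseq p R) hl i
  obtain ⟨h1, h2⟩ := hy k hk k hk le_rfl
  obtain ⟨i, rfl⟩ := Nat.exists_eq_add_of_le' hLi
  rw [Lseq_succ m _ l hk] at hiL
  rw [hitin, fc_eq_gf, Function.iterate_add_apply]
  set z := (gf p fun j => (c j)⁻¹)^[Lseq m (nseq p R) l k] y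
  have he := hA.entry k hk
  have hnorm : i ≤ m k + nseq p R k →
      ‖(gf p fun j => (c j)⁻¹)^[i] z‖ = (phi p R)^[i] (r k) := fun hi => by
    rw [← h1]
    refine norm_iterate_gf_eq hR hpK hv fun i' hi' => ?_
    rw [h1]
    exact he.iter_ne i' (by omega)
  split_ifs with hm hn
  · refine mem_Bset_zero_iff.2 ?_
    rw [hnorm (by omega)]
    exact he.iter_lt_one i (by omega)
  · refine mem_Aset_iff.2 fun j => ?_
    rcases Nat.eq_zero_or_pos j with rfl | hj
    · rw [mem_Bset_zero_iff, not_lt, hnorm (by omega)]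
      exact he.one_le_iter i (by omega)
    · rw [mem_Bset_iff hR hc hj]
      intro h
      refine he.iter_ne i (by omega) j hj ?_
      rw [← hnorm (by omega), norm_eq_of_norm_one_sub_lt hR hv hj h]
  · refine (mem_Bset_iff hR hc hk).2 ?_
    obtain ⟨i, rfl⟩ := Nat.exists_eq_add_of_le' (by omega : m k + nseq p R k ≤ i)
    rw [Function.iterate_add_apply]
    exact h2 i (by omega)

end Main

/-- **Theorem 3.9** (quantified main theorem). Under conditions (3.2)–(3.5) for all
`k ≥ 1`, if `x` has itinerary `B_0^{m_1} A^{n_1} B_1^∞` under `f_c`, then there is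
`c' ∈ Δ_2(c, ε)` such that every point of the disk `{|y - x| < ϱ²}` lies in the
cylinder `C_{c'}(α)` of the itinerary `α` associated to `m` and `ℓ`; in particular
`x` itself has itinerary `α` under `f_{c'}`. -/
theorem quantified_main
    (p : ℕ) [Fact p.Prime] (K : Type*) [NontriviallyNormedField K] [Algebra ℚ_[p] K]
    (hK : IsCp p K) (R : ℕ → ℝ) (hR : IsGenericRadii p R)
    (c : ℕ → K) (hc : InC p R c)
    (ε : ℕ → ℝ) (hε : ∀ j, 2 ≤ j → 0 < ε j ∧ ε j < R j)
    (m : ℕ → ℕ) (hm : ∀ j, 1 ≤ j → 1 ≤ m j)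
    (l : ℕ → ℕ) (hl : ∀ j, 2 ≤ j → 1 ≤ l j)
    (h32 : ∀ k, 1 ≤ k → Cond32 p R m l k)
    (h33 : ∀ k, 1 ≤ k → Cond33 p R ε l k)
    (h34 : ∀ k, 1 ≤ k → Cond34 p R m l k)
    (h35 : ∀ k, 1 ≤ k → Cond35 p R ε l k)
    (x : K)
    (hx0 : ∀ n, n < m 1 → (fc p c)^[n] x ∈ Bset R c 0)
    (hxA : ∀ n, m 1 ≤ n → n < m 1 + nseq p R 1 → (fc p c)^[n] x ∈ Aset R c)
    (hx1 : ∀ n, m 1 + nseq p R 1 ≤ n → (fc p c)^[n] x ∈ Bset R c 1) :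
    ∃ c' : ℕ → K, InDelta p R c ε 2 c' ∧
      (∀ y : K, ‖y - x‖ < rho p ^ 2 →
        ∀ i : ℕ, (fc p c')^[i] y ∈ symbSet R c' (itin m (nseq p R) l i)) ∧
      (∀ i : ℕ, (fc p c')^[i] x ∈ symbSet R c' (itin m (nseq p R) l i)) := by
  have hna : IsUltrametricDist K :=
    IsUltrametricDist.isUltrametricDist_of_forall_norm_add_le_max_norm hK.isNonarch
  have hcomplete := hK.complete
  have hclosed := hK.isAlgClosed
  have hpK : ‖(p : K)‖ = (p : ℝ)⁻¹ := by
    rw [← map_natCast (algebraMap ℚ_[p] K), hK.norm_extends, Padic.norm_p]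
  obtain ⟨r, hA⟩ := exists_admissible hR hε hm hl h32 h33 h34 h35
  obtain ⟨hf, hend⟩ := followsBlocks_one hA hpK hc hx0 hxA hx1
  obtain ⟨u, hu, hu1, hdist, hall⟩ := hf.exists_forall hA hpK hc.invRadii hend
  have hitin : ∀ y : K, ‖y - x‖ < rho p ^ 2 → ∀ i : ℕ,
      (fc p fun j => (u j)⁻¹)^[i] y ∈ symbSet R (fun j => (u j)⁻¹) (itin m (nseq p R) l i) :=
    fun y hy => mem_symbSet_of_followsBlocks hA hpK hl hu.inC (by simpa using hall y hy)
  refine ⟨fun j => (u j)⁻¹, ⟨hu.inC, fun j hj hj2 => ?_, fun j hj => ?_⟩, hitin,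
    hitin x (by simpa using pow_pos rho_pos 2)⟩
  · obtain rfl : j = 1 := by omega
    simp [hu1]
  · obtain ⟨k, rfl⟩ := Nat.exists_eq_add_of_le' (by omega : 1 ≤ j)
    have hk : 1 ≤ k := by omega
    have hRj := hR.1.pos (by omega : 1 ≤ k + 1)
    have hc0 : (c (k + 1))⁻¹ ≠ 0 := inv_ne_zero (norm_pos_iff.1 (hc (k + 1) (by omega) ▸ hRj))
    have hu0 : u (k + 1) ≠ 0 := norm_pos_iff.1 (by rw [hu _ (by omega)]; positivity)
    have h1 := norm_inv_sub_inv_eq hu0 hc0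
    rw [inv_inv, hu _ (by omega), norm_inv, hc _ (by omega), norm_sub_rev (u _)] at h1
    have h2 := paramRadius_mul_sq_lt hR.1 hk (hA.Sse_pos hk) (h35 k hk)
    have h3 := mul_le_mul_of_nonneg_right (hdist k hk) (sq_nonneg (R (k + 1)))
    have h4 := mul_lt_of_lt_one_left (hε (k + 1) hj).1 (rho_lt_one (p := p))
    calc ‖(u (k + 1))⁻¹ - c (k + 1)‖
        = ‖(c (k + 1))⁻¹ - u (k + 1)‖ * R (k + 1) ^ 2 := by rw [h1]; field_simp
      _ ≤ paramRadius p R l k * R (k + 1) ^ 2 := h3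
      _ < rho p * ε (k + 1) := h2
      _ < ε (k + 1) := h4
end
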